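/- Let d ≥ 1 and let τ = (τ_1,…,τ_d) satisfy 1/d ≤ τ_1 ≤ τ_2 ≤ … ≤ τ_d. Let W(τ) = { (x_1,…,x_d) ∈ 𝕋^d : max_j { q^{τ_j} ‖q x_j‖ } < 1 for infinitely many q ∈ ℕ }, and let D(τ) = min{ (d + 1 + j τ_j − Σ_{i=1}^j τ_i)/(1 + τ_j) : 1 ≤ j ≤ d }. Then W(τ) ∈ 𝒢^{D(τ)}(𝕋^d). -/

import Mathlib

open MeasureTheory Metric Filter Set
open scoped ENNReal Topology

noncomputable section

/-- The `d`-dimensional torus `ℝ^d / ℤ^d`. -/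
abbrev Torus (d : ℕ) := Fin d → AddCircle (1 : ℝ)

/-- The canonical projection `ℝ^d → 𝕋^d`. -/
def torusProj {d : ℕ} (y : Fin d → ℝ) : Torus d := fun i => (y i : AddCircle (1 : ℝ))

/-- A dyadic cube in the torus: the image under the projection `ℝ^d → 𝕋^d` of a product
of intervals `[kᵢ 2^{-n}, (kᵢ+1) 2^{-n})`. -/
def IsDyadicCube {d : ℕ} (D : Set (Torus d)) : Prop :=
  ∃ (n : ℕ) (k : Fin d → ℤ),
    D = torusProj ''
      (Set.univ.pi fun i => Set.Ico ((k i : ℝ) / 2 ^ n) (((k i : ℝ) + 1) / 2 ^ n))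

/-- The outer dyadic content `ℳ_∞^t(E) = inf { Σ_k |D_k|^t : E ⊆ ⋃_k D_k, D_k dyadic }`. -/
noncomputable def dyadicContent {d : ℕ} (t : ℝ) (E : Set (Torus d)) : ℝ≥0∞ :=
  ⨅ (f : ℕ → Set (Torus d)) (_ : ∀ n, IsDyadicCube (f n)) (_ : E ⊆ ⋃ n, f n),
    ∑' n, EMetric.diam (f n) ^ t

/-- Falconer's class `𝒢^s(𝕋^d)` of sets with large intersections: `G_δ` sets `E` with
`ℳ_∞^t(E ∩ D) ≥ |D|^t` for all dyadic cubes `D` and all `t < s`. -/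
def MemLargeIntersectionClass {d : ℕ} (s : ℝ) (E : Set (Torus d)) : Prop :=
  IsGδ E ∧ ∀ D : Set (Torus d), IsDyadicCube D → ∀ t : ℝ, t < s →
    EMetric.diam D ^ t ≤ dyadicContent t (E ∩ D)

/-- The set `W(τ)` of points `x ∈ 𝕋^d` such that `max_j q^{τ_j} ‖q x_j‖ < 1` for
infinitely many `q ∈ ℕ`, where `‖·‖` is the distance to the nearest integer. -/
def Wset (d : ℕ) (τ : Fin d → ℝ) : Set (Torus d) :=
  {x | {q : ℕ | 0 < q ∧ ∀ i, (q : ℝ) ^ (τ i) * ‖q • x i‖ < 1}.Infinite}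

/-- The dimension value
`D(τ) = min_{1 ≤ j ≤ d} (d + 1 + j τ_j - Σ_{i=1}^j τ_i) / (1 + τ_j)`. -/
noncomputable def Dval (d : ℕ) (τ : Fin d → ℝ) : ℝ :=
  ⨅ j : Fin d,
    ((d : ℝ) + 1 + ((j : ℕ) + 1) * τ j - ∑ i ∈ Finset.univ.filter (· ≤ j), τ i) /
      (1 + τ j)

theorem UnitAddCircle.exists_real_abs_eq_norm (x : AddCircle (1 : ℝ)) :
    ∃ v : ℝ, (v : AddCircle (1 : ℝ)) = x ∧ |v| = ‖x‖ := by
  obtain ⟨y, rfl⟩ := QuotientAddGroup.mk_surjective x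
  refine ⟨y - round y, ?_, (UnitAddCircle.norm_eq (x := y)).symm⟩
  have : ((round y : ℝ) : AddCircle (1 : ℝ)) = 0 := by
    rw [AddCircle.coe_eq_zero_iff]
    exact ⟨round y, by simp⟩
  rw [AddCircle.coe_sub, this, sub_zero]

theorem UnitAddCircle.norm_coe_le_abs (v : ℝ) : ‖(v : AddCircle (1 : ℝ))‖ ≤ |v| := by
  rw [UnitAddCircle.norm_eq]
  simpa using round_le v 0

theorem UnitAddCircle.exists_torsion_near {q : ℕ} (hq : 0 < q) (x : AddCircle (1 : ℝ)) :
    ∃ z : AddCircle (1 : ℝ), q • z = 0 ∧ dist x z ≤ ‖q • x‖ / q := by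
  obtain ⟨y, rfl⟩ := QuotientAddGroup.mk_surjective x
  have hq' : (0 : ℝ) < q := by exact_mod_cast hq
  refine ⟨((round (q * y) / q : ℝ) : AddCircle (1 : ℝ)), ?_, ?_⟩
  · rw [← AddCircle.coe_nsmul, AddCircle.coe_eq_zero_iff]
    exact ⟨round (q * y), by simp; field_simp⟩
  · change dist (y : AddCircle (1 : ℝ)) _ ≤ ‖q • (y : AddCircle (1 : ℝ))‖ / q
    rw [dist_eq_norm, ← AddCircle.coe_sub, ← AddCircle.coe_nsmul,
      UnitAddCircle.norm_eq (x := q • y), nsmul_eq_mul]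
    refine (UnitAddCircle.norm_coe_le_abs _).trans ?_
    rw [le_div_iff₀ hq', ← abs_of_pos hq', ← abs_mul, abs_of_pos hq']
    apply le_of_eq
    congr 1
    field_simp

theorem UnitAddCircle.volume_norm_nsmul_le {q : ℕ} (hq : 0 < q) (δ : ℝ) :
    volume {x : AddCircle (1 : ℝ) | ‖q • x‖ ≤ δ} ≤ ENNReal.ofReal (2 * δ) := by
  have hmp : MeasurePreserving (fun y : AddCircle (1 : ℝ) => q • y) := by
    rcases Nat.lt_or_ge 1 q with h | h
    · exact (AddCircle.ergodic_nsmul h).toMeasurePreserving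
    · obtain rfl : q = 1 := by omega
      simp only [one_smul]
      exact MeasurePreserving.id _
  have : {x : AddCircle (1 : ℝ) | ‖q • x‖ ≤ δ} = (fun y => q • y) ⁻¹' closedBall 0 δ := by
    ext x; simp
  rw [this, hmp.measure_preimage measurableSet_closedBall.nullMeasurableSet,
    AddCircle.volume_closedBall]
  exact ENNReal.ofReal_le_ofReal (min_le_right _ _)

theorem UnitAddCircle.mul_volume_norm_nsmul_le_inter_closedBall {q : ℕ} (hq : 0 < q) (δ : ℝ)
    (c : AddCircle (1 : ℝ)) :
    q * volume ({x : AddCircle (1 : ℝ) | ‖q • x‖ ≤ δ} ∩ closedBall c (1 / (2 * q))) ≤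
      ENNReal.ofReal (2 * δ) := by
  have hord : addOrderOf (((1 : ℝ) / q : ℝ) : AddCircle (1 : ℝ)) = q :=
    AddCircle.addOrderOf_period_div hq
  have h := AddCircle.volume_of_add_preimage_eq {x : AddCircle (1 : ℝ) | ‖q • x‖ ≤ δ}
    (closedBall c (1 / (2 * q))) (((1 : ℝ) / q : ℝ) : AddCircle (1 : ℝ)) c
    (addOrderOf_pos_iff.mp (by rw [hord]; exact hq)) ?_
    (by rw [hord]; exact AddCircle.closedBall_ae_eq_ball)
  · rw [hord, nsmul_eq_mul] at h
    rw [← h]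
    exact UnitAddCircle.volume_norm_nsmul_le hq δ
  · apply Filter.EventuallyEq.of_eq
    refine Set.ext fun x => ?_
    rw [Set.mem_vadd_set_iff_neg_vadd_mem]
    have h0 : q • (((1 : ℝ) / q : ℝ) : AddCircle (1 : ℝ)) = 0 := by
      have h := addOrderOf_nsmul_eq_zero (((1 : ℝ) / q : ℝ) : AddCircle (1 : ℝ))
      rwa [hord] at h
    simp only [vadd_eq_add, mem_ofPred_eq, smul_add, smul_neg, h0, neg_zero, zero_add]

theorem UnitAddCircle.volume_norm_nsmul_le_inter_closedBall {q : ℕ} (hq : 0 < q) {δ : ℝ}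
    (hδ : 0 ≤ δ) (c : AddCircle (1 : ℝ)) {s : ℝ} (hs : 0 ≤ s) :
    volume ({x : AddCircle (1 : ℝ) | ‖q • x‖ ≤ δ} ∩ closedBall c s) ≤
      ENNReal.ofReal (4 * δ * (s + 2 / q)) := by
  have hq' : (0 : ℝ) < q := by exact_mod_cast hq
  set J : ℕ := ⌈s * q⌉₊
  have hJ : (J : ℝ) < s * q + 1 := Nat.ceil_lt_add_one (by positivity)
  have hcov : {x : AddCircle (1 : ℝ) | ‖q • x‖ ≤ δ} ∩ closedBall c s ⊆
      ⋃ j ∈ Finset.range (2 * J + 1), {x : AddCircle (1 : ℝ) | ‖q • x‖ ≤ δ} ∩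
        closedBall (c + ((((j : ℝ) - J) / q : ℝ) : AddCircle (1 : ℝ))) (1 / (2 * q)) := by
    rintro x ⟨hx, hxc⟩
    obtain ⟨v, hv, hvn⟩ := UnitAddCircle.exists_real_abs_eq_norm (x - c)
    rw [mem_closedBall, dist_eq_norm, ← hvn] at hxc
    have h1 : |v * q| ≤ J := by
      rw [abs_mul, abs_of_pos hq']
      exact (mul_le_mul_of_nonneg_right hxc hq'.le).trans (Nat.le_ceil _)
    have h2 : round (v * q) ≤ (J : ℤ) := by
      have : v * q ≤ (J : ℤ) := by exact_mod_cast (abs_le.mp h1).2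
      rw [round_eq, Int.floor_le_iff]
      push_cast at *
      linarith
    have h3 : -(J : ℤ) ≤ round (v * q) := by
      have := (abs_le.mp h1).1
      rw [round_eq, Int.le_floor]
      push_cast
      linarith
    simp only [mem_iUnion, exists_prop]
    refine ⟨(round (v * q) + J).toNat, ?_, hx, ?_⟩
    · rw [Finset.mem_range]; omega
    · have h4 : (((round (v * q) + J).toNat : ℕ) : ℝ) = round (v * q) + J := by
        have : (((round (v * q) + J).toNat : ℕ) : ℤ) = round (v * q) + J :=
          Int.toNat_of_nonneg (by omega)
        exact_mod_cast this
      rw [mem_closedBall, dist_eq_norm, h4, add_sub_cancel_right, ← sub_sub, ← hv,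
        ← AddCircle.coe_sub]
      refine (UnitAddCircle.norm_coe_le_abs _).trans ?_
      have := abs_sub_round (v * q)
      rw [le_div_iff₀ (by positivity)]
      have h5 : v - round (v * q) / q = (v * q - round (v * q)) / q := by field_simp
      rw [h5, abs_div, abs_of_pos hq']
      field_simp
      linarith
  have hone : ∀ c', volume ({x : AddCircle (1 : ℝ) | ‖q • x‖ ≤ δ} ∩ closedBall c' (1 / (2 * q)))
      ≤ ENNReal.ofReal (2 * δ / q) := by
    intro c'
    rw [ENNReal.ofReal_div_of_pos hq', ENNReal.ofReal_natCast, ENNReal.le_div_iff_mul_le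
      (Or.inl (by exact_mod_cast hq.ne')) (Or.inl (ENNReal.natCast_ne_top _)), mul_comm]
    exact UnitAddCircle.mul_volume_norm_nsmul_le_inter_closedBall hq δ c'
  calc _ ≤ ∑ j ∈ Finset.range (2 * J + 1), volume ({x : AddCircle (1 : ℝ) | ‖q • x‖ ≤ δ} ∩
        closedBall (c + ((((j : ℝ) - J) / q : ℝ) : AddCircle (1 : ℝ))) (1 / (2 * q))) :=
        (measure_mono hcov).trans (measure_biUnion_finset_le _ _)
    _ ≤ ∑ j ∈ Finset.range (2 * J + 1), ENNReal.ofReal (2 * δ / q) :=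
        Finset.sum_le_sum fun j _ => hone _
    _ = ENNReal.ofReal ((2 * J + 1 : ℕ) * (2 * δ / q)) := by
        rw [Finset.sum_const, Finset.card_range, nsmul_eq_mul, ENNReal.ofReal_mul (by positivity),
          ENNReal.ofReal_natCast]
    _ ≤ _ := by
        apply ENNReal.ofReal_le_ofReal
        push_cast
        have : 4 * δ * (s + 2 / q) = (2 * (s * q + 2)) * (2 * δ / q) := by
          field_simp
          ring
        rw [this]
        apply mul_le_mul_of_nonneg_right _ (by positivity)
        linarith

theorem Torus.volume_closedBall {d : ℕ} (x : Torus d) {r : ℝ} (hr : 0 ≤ r) (hr' : r ≤ 1 / 2) :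
    volume (closedBall x r) = ENNReal.ofReal ((2 * r) ^ d) := by
  rw [volume_pi_closedBall x hr]
  simp only [AddCircle.volume_closedBall]
  rw [min_eq_right (by linarith), Finset.prod_const, ENNReal.ofReal_pow (by linarith)]
  simp

theorem Torus.volume_closedBall_le {d : ℕ} (x : Torus d) {r : ℝ} (hr : 0 ≤ r) :
    volume (closedBall x r) ≤ ENNReal.ofReal ((2 * r) ^ d) := by
  rw [volume_pi_closedBall x hr]
  simp only [AddCircle.volume_closedBall]
  rw [Finset.prod_const, ENNReal.ofReal_pow (by linarith), Finset.card_univ, Fintype.card_fin]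
  gcongr
  exact min_le_right _ _

theorem Torus.volume_univ (d : ℕ) : volume (univ : Set (Torus d)) = 1 := by
  simp [volume_pi, Measure.pi_univ]

theorem Torus.volume_norm_nsmul_le_inter_closedBall {d : ℕ} {q : ℕ} (hq : 0 < q) {δ : ℝ}
    (hδ : 0 ≤ δ) (c : Torus d) {s : ℝ} (hs : 0 ≤ s) :
    volume ({x : Torus d | ∀ i, ‖q • x i‖ ≤ δ} ∩ closedBall c s) ≤
      ENNReal.ofReal ((4 * δ * (s + 2 / q)) ^ d) := by
  have : {x : Torus d | ∀ i, ‖q • x i‖ ≤ δ} ∩ closedBall c s =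
      univ.pi fun i => {x : AddCircle (1 : ℝ) | ‖q • x‖ ≤ δ} ∩ closedBall (c i) s := by
    rw [closedBall_pi _ hs]
    ext x
    simp [Set.mem_pi, forall_and]
  rw [this, volume_pi_pi, ENNReal.ofReal_pow (by positivity)]
  calc _ ≤ ∏ _i : Fin d, ENNReal.ofReal (4 * δ * (s + 2 / q)) :=
        Finset.prod_le_prod' fun i _ =>
          UnitAddCircle.volume_norm_nsmul_le_inter_closedBall hq hδ (c i) hs
    _ = _ := by simp

/-- Dirichlet's theorem on simultaneous approximation. -/
theorem Torus.exists_norm_nsmul_le {d : ℕ} (x : Torus d) {n : ℕ} (hn : 0 < n) {δ : ℝ}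
    (hδ0 : 0 ≤ δ) (hδ1 : δ ≤ 1) (hδ : 1 ≤ n * δ ^ d) :
    ∃ q ∈ Set.Icc 1 n, ∀ i, ‖q • x i‖ ≤ δ := by
  obtain ⟨q, hq, h⟩ := NormedAddCommGroup.exists_norm_nsmul_le (μ := volume) x hn δ (by
    rw [Torus.volume_univ, Torus.volume_closedBall 0 (by positivity) (by linarith), nsmul_eq_mul,
      mul_div_cancel₀ _ two_ne_zero]
    calc (1 : ℝ≥0∞) = ENNReal.ofReal 1 := by simp
      _ ≤ ENNReal.ofReal (n * δ ^ d) := ENNReal.ofReal_le_ofReal hδ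
      _ = n * ENNReal.ofReal (δ ^ d) := by
        rw [ENNReal.ofReal_mul (by positivity), ENNReal.ofReal_natCast]
      _ ≤ _ := by push_cast; gcongr; exact le_self_add)
  exact ⟨q, hq, fun i => (norm_le_pi_norm (q • x) i).trans h⟩

theorem eventually_sum_pow_add_div_le (d : ℕ) {s : ℝ} (hs : 0 < s) :
    ∀ᶠ H : ℕ in atTop, ∑ q ∈ Finset.range ⌈(H : ℝ) / 4 ^ (d + 2)⌉₊, (s + 2 / (q : ℝ)) ^ d ≤
      H / 4 ^ (d + 1) * s ^ d := by
  have hu : Tendsto (fun q : ℕ => (s + 2 / (q : ℝ)) ^ d) atTop (𝓝 (s ^ d)) := by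
    have := ((tendsto_const_nhds (x := s)).add
      (tendsto_const_div_atTop_nhds_zero_nat (2 : ℝ))).pow d
    simpa using this
  have hn : Tendsto (fun H : ℕ => ⌈(H : ℝ) / 4 ^ (d + 2)⌉₊) atTop atTop :=
    tendsto_nat_ceil_atTop.comp (tendsto_natCast_atTop_atTop.atTop_div_const (by positivity))
  have h2 : s ^ d < 2 * s ^ d := by have := pow_pos hs d; linarith
  filter_upwards [hn.eventually (hu.cesaro.eventually_lt_const h2),
    eventually_ge_atTop (4 ^ (d + 2))] with H hH hHd
  have hH1 : (1 : ℝ) ≤ (H : ℝ) / 4 ^ (d + 2) := by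
    rw [le_div_iff₀ (by positivity), one_mul]; exact_mod_cast hHd
  set n := ⌈(H : ℝ) / 4 ^ (d + 2)⌉₊
  have hn0 : (0 : ℝ) < n := by
    exact_mod_cast Nat.ceil_pos.mpr (by linarith)
  have hn1 : (n : ℝ) < (H : ℝ) / 4 ^ (d + 2) + 1 := Nat.ceil_lt_add_one (by positivity)
  rw [inv_mul_lt_iff₀ hn0] at hH
  refine hH.le.trans ?_
  have : (H : ℝ) / 4 ^ (d + 1) = 4 * ((H : ℝ) / 4 ^ (d + 2)) := by
    rw [pow_succ (4 : ℝ) (d + 1)]; field_simp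
  rw [this, mul_left_comm, ← mul_assoc]
  apply mul_le_mul_of_nonneg_right _ (by positivity)
  linarith

/-- Points of a ball well approximated by rationals with denominator comparable to `H` fill
at least half of the ball, once `H` is large. -/
theorem eventually_volume_approx_ge {d : ℕ} (hd : 0 < d) (c : Torus d) {s : ℝ} (hs : 0 < s)
    (hs' : s ≤ 1 / 2) :
    ∀ᶠ H : ℕ in atTop, ENNReal.ofReal ((2 * s) ^ d / 2) ≤
      volume ({x : Torus d | ∃ q : ℕ, (H : ℝ) / 4 ^ (d + 2) ≤ q ∧ q ≤ H ∧
        ∀ i, ‖q • x i‖ ≤ (H : ℝ) ^ (-(1 / (d : ℝ)))} ∩ closedBall c s) := by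
  filter_upwards [eventually_sum_pow_add_div_le d hs, eventually_ge_atTop 1] with H hH hH1
  have hH1' : (1 : ℝ) ≤ H := by exact_mod_cast hH1
  have hd' : (d : ℝ) ≠ 0 := by positivity
  set δ := (H : ℝ) ^ (-(1 / (d : ℝ))) with hδ
  have hδ0 : 0 ≤ δ := by positivity
  have hδ1 : δ ≤ 1 := Real.rpow_le_one_of_one_le_of_nonpos hH1' (by simp)
  have hδd : δ ^ d = (H : ℝ)⁻¹ := by
    rw [hδ, ← Real.rpow_natCast, ← Real.rpow_mul (by positivity), neg_mul, one_div,
      inv_mul_cancel₀ hd', Real.rpow_neg_one]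
  set n := ⌈(H : ℝ) / 4 ^ (d + 2)⌉₊
  set G := {x : Torus d | ∃ q : ℕ, (H : ℝ) / 4 ^ (d + 2) ≤ q ∧ q ≤ H ∧ ∀ i, ‖q • x i‖ ≤ δ}
  have hcov : closedBall c s ⊆ (G ∩ closedBall c s) ∪
      ⋃ q ∈ (Finset.range n).filter (0 < ·), ({x : Torus d | ∀ i, ‖q • x i‖ ≤ δ} ∩
        closedBall c s) := by
    intro x hx
    obtain ⟨q, hq, h⟩ := Torus.exists_norm_nsmul_le x hH1 hδ0 hδ1
      (by rw [hδd]; exact (mul_inv_cancel₀ (by positivity)).ge)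
    by_cases hqn : (H : ℝ) / 4 ^ (d + 2) ≤ q
    · exact Or.inl ⟨⟨q, hqn, hq.2, h⟩, hx⟩
    · right
      simp only [mem_iUnion, exists_prop]
      exact ⟨q, by simpa using ⟨Nat.lt_ceil.mpr (not_le.mp hqn), hq.1⟩, h, hx⟩
  have hbad : volume (⋃ q ∈ (Finset.range n).filter (0 < ·),
      ({x : Torus d | ∀ i, ‖q • x i‖ ≤ δ} ∩ closedBall c s)) ≤
      ENNReal.ofReal ((2 * s) ^ d / 2) := by
    calc _ ≤ ∑ q ∈ (Finset.range n).filter (0 < ·),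
          ENNReal.ofReal ((4 * δ * (s + 2 / q)) ^ d) :=
          (measure_biUnion_finset_le _ _).trans (Finset.sum_le_sum fun q hq =>
            Torus.volume_norm_nsmul_le_inter_closedBall (Finset.mem_filter.mp hq).2 hδ0 c hs.le)
      _ ≤ ∑ q ∈ Finset.range n, ENNReal.ofReal ((4 * δ * (s + 2 / q)) ^ d) :=
          Finset.sum_le_sum_of_subset (Finset.filter_subset _ _)
      _ = ENNReal.ofReal (∑ q ∈ Finset.range n, (4 * δ * (s + 2 / q)) ^ d) :=
          (ENNReal.ofReal_sum_of_nonneg fun q _ => by positivity).symm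
      _ ≤ _ := by
          apply ENNReal.ofReal_le_ofReal
          simp only [mul_pow _ (s + _)]
          rw [← Finset.mul_sum, mul_pow, hδd]
          refine (mul_le_mul_of_nonneg_left hH (by positivity)).trans ?_
          have h2 : (1 : ℝ) ≤ 2 ^ d := one_le_pow₀ (by norm_num)
          have hsd := pow_pos hs d
          have : 4 ^ d * (H : ℝ)⁻¹ * (H / 4 ^ (d + 1) * s ^ d) = s ^ d / 4 := by
            rw [pow_succ]; field_simp
          rw [this, mul_pow]
          nlinarith
  have h1 := (measure_mono hcov).trans (measure_union_le (μ := volume) _ _)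
  rw [Torus.volume_closedBall c hs.le hs'] at h1
  have h2 : ENNReal.ofReal ((2 * s) ^ d) = ENNReal.ofReal ((2 * s) ^ d / 2) +
      ENNReal.ofReal ((2 * s) ^ d / 2) := by
    rw [← ENNReal.ofReal_add (by positivity) (by positivity), add_halves]
  rw [h2] at h1
  exact (ENNReal.add_le_add_iff_right ENNReal.ofReal_ne_top).mp (h1.trans (by gcongr))

theorem exists_disjoint_refinement {X : Type*} [MeasurableSpace X] (B : X → Set X)
    (hB : ∀ z, MeasurableSet (B z)) (Z : Finset X) (G : Set X) (hG : MeasurableSet G)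
    (hcov : G ⊆ ⋃ z ∈ Z, B z) :
    ∃ S : X → Set X, (∀ z, MeasurableSet (S z)) ∧ (∀ z, S z ⊆ G ∩ B z) ∧
      (Z : Set X).PairwiseDisjoint S ∧ ⋃ z ∈ Z, S z = G := by
  classical
  induction Z using Finset.induction_on generalizing G with
  | empty => exact ⟨fun _ => ∅, by simp, by simp, by simp, by simpa [eq_comm] using hcov⟩
  | insert z₀ Z hz₀ ih =>
    obtain ⟨S, hSm, hSG, hSd, hSU⟩ := ih (G \ B z₀) (hG.diff (hB z₀)) (by
      rintro x ⟨hx, hx₀⟩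
      have := hcov hx
      rw [Finset.set_biUnion_insert] at this
      exact this.resolve_left hx₀)
    have hne : ∀ z ∈ Z, z ≠ z₀ := fun z hz h => hz₀ (h ▸ hz)
    refine ⟨Function.update S z₀ (G ∩ B z₀), fun z => ?_, fun z => ?_, ?_, ?_⟩
    · rcases eq_or_ne z z₀ with rfl | h
      · simpa using hG.inter (hB z)
      · simpa [h] using hSm z
    · rcases eq_or_ne z z₀ with rfl | h
      · simp
      · simpa [h] using ⟨(hSG z).trans fun x hx => hx.1.1, (hSG z).trans fun x hx => hx.2⟩
    · rw [Finset.coe_insert, Set.pairwiseDisjoint_insert_of_notMem (by simpa using hz₀)]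
      refine ⟨fun z hz z' hz' h => ?_, fun z hz => ?_⟩
      · simpa [Function.onFun, hne z hz, hne z' hz'] using hSd hz hz' h
      · rw [Function.update_self, Function.update_of_ne (hne z hz), Set.disjoint_left]
        exact fun x hx hx' => (hSG z hx').1.2 hx.2
    · rw [Finset.set_biUnion_insert, Function.update_self]
      have : ⋃ z ∈ Z, Function.update S z₀ (G ∩ B z₀) z = ⋃ z ∈ Z, S z :=
        Set.iUnion₂_congr fun z hz => Function.update_of_ne (hne z hz) _ _
      rw [this, hSU, inter_union_sdiff]

theorem AddCircle.volume_ball_inter_closedBall_le (z y : AddCircle (1 : ℝ)) {a r θ : ℝ}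
    (ha : 0 < a) (hr : 0 ≤ r) (hθ : 0 ≤ θ) (hθ' : θ ≤ 1) :
    volume (ball z a ∩ closedBall y r) ≤ ENNReal.ofReal (2 * a * (r / a) ^ θ) := by
  rcases le_total r a with h | h
  · refine (measure_mono inter_subset_right).trans ?_
    rw [AddCircle.volume_closedBall]
    refine ENNReal.ofReal_le_ofReal ((min_le_right _ _).trans ?_)
    have h1 : r / a ≤ (r / a) ^ θ := by
      rcases hr.eq_or_lt with rfl | hr
      · simp; positivity
      · simpa using Real.rpow_le_rpow_of_exponent_ge (by positivity) ((div_le_one ha).mpr h) hθ'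
    calc 2 * r = 2 * a * (r / a) := by field_simp
      _ ≤ _ := by gcongr
  · refine (measure_mono (inter_subset_left.trans ball_subset_closedBall)).trans ?_
    rw [AddCircle.volume_closedBall]
    refine ENNReal.ofReal_le_ofReal ((min_le_right _ _).trans ?_)
    have h1 : 1 ≤ (r / a) ^ θ := Real.one_le_rpow ((one_le_div ha).mpr h) hθ
    nlinarith

/-- Given a measurable set `G` covered by finitely many balls of radius `ρ`, the mass of `G` can
be moved to thin rectangles with the same centres, keeping control on the mass of balls. -/
theorem Torus.exists_measure_on_rectangles {d : ℕ} (Z : Finset (Torus d)) {ρ : ℝ}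
    {a θ : Fin d → ℝ} (ha : ∀ i, 0 < a i) (ha' : ∀ i, a i ≤ 1 / 2) (haρ : ∀ i, a i ≤ ρ)
    (hθ : ∀ i, 0 ≤ θ i) (hθ' : ∀ i, θ i ≤ 1) (hρ : 0 < ρ)
    {G : Set (Torus d)} (hG : MeasurableSet G) (hcov : G ⊆ ⋃ z ∈ Z, closedBall z ρ) :
    ∃ ν : Measure (Torus d), ν ≪ volume ∧ ν univ ≤ volume G ∧
      (∀ y r, 0 < r → ν (closedBall y r) ≤ ENNReal.ofReal ((2 * (r + 2 * ρ)) ^ d)) ∧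
      (∀ y r, 0 < r → ν (closedBall y r) ≤
        ENNReal.ofReal ((2 * (r + 2 * ρ)) ^ d * ∏ i, (r / a i) ^ θ i)) ∧
      ∀ V : Set (Torus d), (∀ z ∈ Z, (G ∩ closedBall z ρ).Nonempty →
        (univ.pi fun i => ball (z i) (a i)) ⊆ V) → volume G ≤ ν V := by
  classical
  obtain ⟨S, hSm, hSG, hSd, hSU⟩ := exists_disjoint_refinement (fun z => closedBall z ρ)
    (fun z => measurableSet_closedBall) Z G hG hcov
  set R : Torus d → Set (Torus d) := fun z => univ.pi fun i => ball (z i) (a i)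
  set v : ℝ≥0∞ := ENNReal.ofReal (∏ i, 2 * a i)
  have hR : ∀ z, volume (R z) = v := by
    intro z
    simp only [R, v]
    rw [volume_pi_pi, ENNReal.ofReal_prod_of_nonneg fun i _ => by have := ha i; positivity]
    refine Finset.prod_congr rfl fun i _ => ?_
    rw [← measure_congr AddCircle.closedBall_ae_eq_ball, AddCircle.volume_closedBall,
      min_eq_right (by have := ha' i; linarith)]
  have hv0 : v ≠ 0 := by
    simp only [v, ne_eq, ENNReal.ofReal_eq_zero, not_le]
    exact Finset.prod_pos fun i _ => by have := ha i; positivity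
  have hvt : v ≠ ⊤ := ENNReal.ofReal_ne_top
  set ν : Measure (Torus d) := ∑ z ∈ Z, (volume (S z) / v) • volume.restrict (R z) with hν
  have hνA : ∀ A, MeasurableSet A → ν A = ∑ z ∈ Z, volume (S z) / v * volume (A ∩ R z) := by
    intro A hA
    simp [hν, Measure.finsetSum_apply, Measure.restrict_apply hA]
  have hsum : ∀ Z' ⊆ Z, ∑ z ∈ Z', volume (S z) = volume (⋃ z ∈ Z', S z) := fun Z' hZ' =>
    (measure_biUnion_finset (hSd.subset (by exact_mod_cast hZ')) fun z _ => hSm z).symm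
  have hball : ∀ (β : ℝ≥0∞) (y : Torus d) (r : ℝ), 0 < r →
      (∀ z, volume (closedBall y r ∩ R z) ≤ v * β) →
      ν (closedBall y r) ≤ ENNReal.ofReal ((2 * (r + 2 * ρ)) ^ d) * β := by
    intro β y r hr hβ
    rw [hνA _ measurableSet_closedBall]
    set Z' := Z.filter fun z => (closedBall y r ∩ R z).Nonempty
    calc _ = ∑ z ∈ Z', volume (S z) / v * volume (closedBall y r ∩ R z) := by
          refine (Finset.sum_filter_of_ne fun z _ hz => ?_).symm
          by_contra h
          rw [Set.not_nonempty_iff_eq_empty] at h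
          simp [h] at hz
      _ ≤ ∑ z ∈ Z', volume (S z) * β := by
          refine Finset.sum_le_sum fun z _ => ?_
          calc _ ≤ volume (S z) / v * (v * β) := by gcongr; exact hβ z
            _ = _ := by rw [← mul_assoc, ENNReal.div_mul_cancel hv0 hvt]
      _ = volume (⋃ z ∈ Z', S z) * β := by
          rw [← Finset.sum_mul, hsum _ (Finset.filter_subset _ _)]
      _ ≤ volume (closedBall y (r + 2 * ρ)) * β := by
          gcongr
          refine iUnion₂_subset fun z hz x hx => ?_
          obtain ⟨u, hu, huz⟩ := (Finset.mem_filter.mp hz).2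
          have h1 : dist x z ≤ ρ := (hSG z hx).2
          have h2 : dist u z ≤ ρ := (dist_pi_le_iff hρ.le).mpr fun i =>
            (mem_ball.mp (huz i (mem_univ i))).le.trans (haρ i)
          have h3 : dist u y ≤ r := hu
          rw [mem_closedBall]
          have := dist_triangle4 x z u y
          rw [dist_comm z u] at this
          linarith
      _ ≤ _ := by
          gcongr
          exact Torus.volume_closedBall_le y (by positivity)
  refine ⟨ν, ?_, ?_, ?_, ?_, ?_⟩
  · refine Measure.AbsolutelyContinuous.mk fun A hA h0 => ?_
    rw [hνA A hA]
    refine Finset.sum_eq_zero fun z _ => ?_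
    rw [measure_mono_null inter_subset_left h0, mul_zero]
  · rw [hνA _ MeasurableSet.univ]
    simp only [univ_inter, hR, ENNReal.div_mul_cancel hv0 hvt]
    rw [hsum _ subset_rfl, hSU]
  · intro y r hr
    have := hball 1 y r hr fun z => by
      rw [mul_one, ← hR z]
      exact measure_mono inter_subset_right
    rwa [mul_one] at this
  · intro y r hr
    rw [ENNReal.ofReal_mul (by positivity)]
    refine hball _ y r hr fun z => ?_
    rw [closedBall_pi _ hr.le, inter_comm, ← Set.pi_inter_distrib, volume_pi_pi,
      ← ENNReal.ofReal_mul (Finset.prod_nonneg fun i _ => by have := ha i; positivity),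
      ← Finset.prod_mul_distrib, ENNReal.ofReal_prod_of_nonneg
        fun i _ => by have := ha i; positivity]
    exact Finset.prod_le_prod' fun i _ =>
      AddCircle.volume_ball_inter_closedBall_le _ _ (ha i) hr.le (hθ i) (hθ' i)
  · intro V hV
    calc volume G = ∑ z ∈ Z, volume (S z) := by rw [hsum _ subset_rfl, hSU]
      _ ≤ ∑ z ∈ Z, volume (S z) / v * volume.restrict (R z) V := by
          refine Finset.sum_le_sum fun z hz => ?_
          rcases (S z).eq_empty_or_nonempty with h | h
          · simp [h]
          · have h1 : volume (R z) ≤ volume.restrict (R z) V := by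
              rw [← Measure.restrict_apply_self]
              exact measure_mono (hV z hz (h.mono (hSG z)))
            calc volume (S z) = volume (S z) / v * volume (R z) := by
                  rw [hR, ENNReal.div_mul_cancel hv0 hvt]
              _ ≤ _ := by gcongr
      _ = ν V := by simp [hν, Measure.finsetSum_apply]

theorem Dval_le (d : ℕ) (τ : Fin d → ℝ) (j : Fin d) :
    Dval d τ ≤ ((d : ℝ) + 1 + ((j : ℕ) + 1) * τ j - ∑ i ∈ Finset.univ.filter (· ≤ j), τ i) /
      (1 + τ j) :=
  ciInf_le (Set.finite_range _).bddBelow j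

theorem Dval_le_natCast {d : ℕ} (hd : 0 < d) (τ : Fin d → ℝ) (hτlow : ∀ i, 1 / (d : ℝ) ≤ τ i) :
    Dval d τ ≤ d := by
  have hd' : (0 : ℝ) < d := by exact_mod_cast hd
  refine (Dval_le d τ ⟨0, hd⟩).trans ?_
  have h : Finset.univ.filter (· ≤ (⟨0, hd⟩ : Fin d)) = {⟨0, hd⟩} := by
    ext i
    simp only [Finset.mem_filter, Finset.mem_univ, true_and, Finset.mem_singleton, Fin.ext_iff,
      Fin.le_def]
    omega
  have h1 := hτlow ⟨0, hd⟩
  have h0 : (0 : ℝ) < 1 / d := by positivity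
  rw [h, Finset.sum_singleton, div_le_iff₀ (by linarith)]
  rw [div_le_iff₀ hd'] at h1
  push_cast
  linarith

theorem exists_weights_of_lt_Dval {d : ℕ} (hd : 0 < d) (τ : Fin d → ℝ)
    (hτlow : ∀ i, 1 / (d : ℝ) ≤ τ i) {t : ℝ} (ht : 0 < t) (htD : t < Dval d τ) :
    ∃ θ : Fin d → ℝ, (∀ i, 0 ≤ θ i) ∧ (∀ i, θ i ≤ 1) ∧ ∑ i, θ i = t ∧
      ∑ i, θ i * (1 + τ i) < d + 1 := by
  have htd : t < d := htD.trans_le (Dval_le_natCast hd τ hτlow)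
  have hjd : ⌊t⌋₊ < d := (Nat.floor_lt ht.le).mpr htd
  set j : Fin d := ⟨⌊t⌋₊, hjd⟩ with hj
  have hj1 : ((j : ℕ) : ℝ) ≤ t := Nat.floor_le ht.le
  have hj2 : t < (j : ℕ) + 1 := Nat.lt_floor_add_one t
  have h0 : (0 : ℝ) < 1 / d := by positivity
  have hτj : 0 < 1 + τ j := by have := hτlow j; linarith
  have hcard : (Finset.univ.filter (· ≤ j)).card = (j : ℕ) + 1 := by
    have : Finset.univ.filter (· ≤ j) = Finset.Iic j := by ext; simp
    rw [this, Fin.card_Iic]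
  set θ : Fin d → ℝ := fun i => if i ≤ j then (if i = j then t - (j : ℕ) else 1) else 0 with hθ
  have hsum : ∑ i, θ i = t := by
    have h1 : ∀ i ∈ Finset.univ.filter (· ≤ j), (if i = j then t - (j : ℕ) else (1 : ℝ)) =
        1 - if i = j then 1 - (t - (j : ℕ)) else 0 := by
      intro i _
      split_ifs <;> ring
    simp only [hθ]
    rw [← Finset.sum_filter, Finset.sum_congr rfl h1, Finset.sum_sub_distrib,
      Finset.sum_ite_eq' _ j]
    simp only [Finset.sum_const, hcard, nsmul_eq_mul, Finset.mem_filter, Finset.mem_univ,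
      le_refl, and_self, if_true]
    push_cast
    ring
  refine ⟨θ, fun i => ?_, fun i => ?_, hsum, ?_⟩
  · simp only [hθ]; split_ifs <;> linarith
  · simp only [hθ]; split_ifs <;> linarith
  · have h1 : ∑ i, θ i * (1 + τ i) = t * (1 + τ j) + ∑ i, θ i * (τ i - τ j) := by
      rw [← hsum, Finset.sum_mul, ← Finset.sum_add_distrib]
      exact Finset.sum_congr rfl fun i _ => by ring
    have h2 : ∑ i, θ i * (τ i - τ j) = ∑ i ∈ Finset.univ.filter (· ≤ j), (τ i - τ j) := by
      rw [Finset.sum_filter]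
      refine Finset.sum_congr rfl fun i _ => ?_
      simp only [hθ]
      split_ifs with h h'
      · simp [h']
      · ring
      · ring
    have h4 := htD.trans_le (Dval_le d τ j)
    rw [lt_div_iff₀ hτj] at h4
    rw [h1, h2, Finset.sum_sub_distrib, Finset.sum_const, hcard, nsmul_eq_mul]
    push_cast
    linarith

/-- The points satisfying the approximation condition of `Wset` for some denominator `≥ N`. -/
def approxFrom {d : ℕ} (τ : Fin d → ℝ) (N : ℕ) : Set (Torus d) :=
  {x | ∃ q : ℕ, N ≤ q ∧ 0 < q ∧ ∀ i, (q : ℝ) ^ (τ i) * ‖q • x i‖ < 1}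

theorem rectangle_subset_approxFrom {d : ℕ} {τ : Fin d → ℝ} (hτ : ∀ i, 0 ≤ τ i) {H N q : ℕ}
    (hq : 0 < q) (hqH : q ≤ H) (hqN : N ≤ q) {z : Torus d} (hz : ∀ i, q • z i = 0) :
    (univ.pi fun i => ball (z i) ((H : ℝ) ^ (-(1 + τ i)))) ⊆ approxFrom τ N := by
  intro x hx
  refine ⟨q, hqN, hq, fun i => ?_⟩
  have hq0 : (0 : ℝ) < q := by exact_mod_cast hq
  have hqH' : (q : ℝ) ≤ H := by exact_mod_cast hqH
  have h1 : dist (x i) (z i) < (H : ℝ) ^ (-(1 + τ i)) := hx i (mem_univ i)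
  have h2 : (H : ℝ) ^ (-(1 + τ i)) ≤ (q : ℝ) ^ (-(1 + τ i)) :=
    Real.rpow_le_rpow_of_nonpos hq0 hqH' (by have := hτ i; linarith)
  have h3 : ‖q • x i‖ ≤ q * dist (x i) (z i) := by
    have : q • x i = q • (x i - z i) := by rw [smul_sub, hz i, sub_zero]
    rw [this, dist_eq_norm]
    simpa using norm_nsmul_le (n := q) (a := x i - z i)
  have h4 : (q : ℝ) ^ (τ i) * (q * (q : ℝ) ^ (-(1 + τ i))) = 1 := by
    rw [← mul_assoc, ← Real.rpow_add_one hq0.ne', ← Real.rpow_add hq0]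
    ring_nf
    simp
  calc _ ≤ (q : ℝ) ^ (τ i) * (q * dist (x i) (z i)) := by gcongr
    _ < (q : ℝ) ^ (τ i) * (q * (q : ℝ) ^ (-(1 + τ i))) := by
      gcongr
      exact h1.trans_le h2
    _ = 1 := h4

theorem finite_torsion_points (d H : ℕ) :
    {z : Torus d | ∃ q : ℕ, 0 < q ∧ q ≤ H ∧ ∀ i, q • z i = 0}.Finite := by
  have : {z : Torus d | ∃ q : ℕ, 0 < q ∧ q ≤ H ∧ ∀ i, q • z i = 0} ⊆
      ⋃ q ∈ Set.Icc 1 H, univ.pi fun _ : Fin d => {u : AddCircle (1 : ℝ) | q • u = 0} := by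
    rintro z ⟨q, h0, h1, h⟩
    simp only [mem_iUnion]
    exact ⟨q, ⟨h0, h1⟩, fun i _ => h i⟩
  refine Set.Finite.subset (Set.Finite.biUnion (Set.finite_Icc 1 H) fun q hq => ?_) this
  exact Set.Finite.pi fun _ => AddCircle.finite_torsion (1 : ℝ) hq.1

theorem exists_measure_ball_approxFrom {d : ℕ} (hd : 0 < d) {τ : Fin d → ℝ}
    (hτlow : ∀ i, 1 / (d : ℝ) ≤ τ i) {t : ℝ} (ht : 0 < t) (htD : t < Dval d τ) :
    ∃ C : ℝ, 0 < C ∧ ∀ (c : Torus d) (L : ℝ), 0 < L → L ≤ 1 / 2 → ∀ N : ℕ,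
      ∃ ν : Measure (Torus d), IsFiniteMeasure ν ∧ ν ≪ volume ∧
        (∀ y r, 0 < r → ν (closedBall y r) ≤ ENNReal.ofReal (C * r ^ t)) ∧
        ENNReal.ofReal (L ^ t / 2) ≤ ν (approxFrom τ N ∩ ball c L) := by
  classical
  obtain ⟨θ, hθ0, hθ1, hθt, hθD⟩ := exists_weights_of_lt_Dval hd τ hτlow ht htD
  have htd : t ≤ d := htD.le.trans (Dval_le_natCast hd τ hτlow)
  have hd0 : (0 : ℝ) < 1 / d := by positivity
  have hτ0 : ∀ i, 0 ≤ τ i := fun i => hd0.le.trans (hτlow i)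
  set K : ℝ := 4 ^ (d + 2) with hK
  have hK1 : 1 ≤ K := one_le_pow₀ (by norm_num)
  have hK0 : 0 < K := by positivity
  refine ⟨(6 * K) ^ d, by positivity, fun c L hL hL' N => ?_⟩
  have hE : Tendsto (fun H : ℕ => (H : ℝ) ^ (-((d : ℝ) + 1 - ∑ i, θ i * (1 + τ i)))) atTop (𝓝 0) :=
    (tendsto_rpow_neg_atTop (by linarith)).comp tendsto_natCast_atTop_atTop
  have hρt : Tendsto (fun H : ℕ => K * (H : ℝ) ^ (-(1 + 1 / (d : ℝ)))) atTop (𝓝 (K * 0)) :=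
    ((tendsto_rpow_neg_atTop (by positivity)).comp tendsto_natCast_atTop_atTop).const_mul K
  rw [mul_zero] at hρt
  have hLd : 0 < L ^ ((d : ℝ) - t) := by positivity
  have hNt : Tendsto (fun H : ℕ => (H : ℝ) / K) atTop atTop :=
    tendsto_natCast_atTop_atTop.atTop_div_const hK0
  obtain ⟨H, hHvol, hHE, hHρ, hHN, hH2⟩ :=
    ((eventually_volume_approx_ge hd c (s := L / 2) (by positivity) (by linarith)).and
      ((hE.eventually_lt_const hLd).and ((hρt.eventually_lt_const (u := L / 4) (by positivity)).and
        ((hNt.eventually_ge_atTop (N + 1 : ℝ)).and (eventually_ge_atTop 2))))).exists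
  have hH2' : (2 : ℝ) ≤ H := by exact_mod_cast hH2
  have hH0 : (0 : ℝ) < H := by linarith
  set δ : ℝ := (H : ℝ) ^ (-(1 / (d : ℝ))) with hδ
  have hδ0 : 0 < δ := by positivity
  set ρ : ℝ := K * (H : ℝ) ^ (-(1 + 1 / (d : ℝ))) with hρ
  have hρ0 : 0 < ρ := by positivity
  have hδρ : δ / (H / K) = ρ := by
    rw [hδ, hρ, neg_add, Real.rpow_add hH0, Real.rpow_neg_one]
    field_simp
  set a : Fin d → ℝ := fun i => (H : ℝ) ^ (-(1 + τ i)) with ha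
  have ha0 : ∀ i, 0 < a i := fun i => by positivity
  have ha2 : ∀ i, a i ≤ 1 / 2 := fun i => by
    calc a i ≤ (H : ℝ) ^ (-1 : ℝ) :=
          Real.rpow_le_rpow_of_exponent_le (by linarith) (by have := hτ0 i; linarith)
      _ ≤ _ := by
          rw [Real.rpow_neg_one, one_div]
          gcongr
  have haρ : ∀ i, a i ≤ ρ := fun i => by
    calc a i ≤ (H : ℝ) ^ (-(1 + 1 / (d : ℝ))) :=
          Real.rpow_le_rpow_of_exponent_le (by linarith) (by have := hτlow i; linarith)
      _ ≤ ρ := le_mul_of_one_le_left (by positivity) hK1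
  set G : Set (Torus d) := {x : Torus d | ∃ q : ℕ, (H : ℝ) / K ≤ q ∧ q ≤ H ∧
        ∀ i, ‖q • x i‖ ≤ δ} ∩ closedBall c (L / 2) with hG
  have hGm : MeasurableSet G := by
    refine MeasurableSet.inter ?_ measurableSet_closedBall
    simp only [Set.ofPred_exists, Set.ofPred_and, Set.ofPred_forall]
    refine MeasurableSet.iUnion fun q => (MeasurableSet.const _).inter
      ((MeasurableSet.const _).inter (MeasurableSet.iInter fun i => ?_))
    exact (isClosed_le (by fun_prop) continuous_const).measurableSet
  have hGvol : volume G ≤ ENNReal.ofReal (L ^ d) := by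
    refine (measure_mono inter_subset_right).trans ?_
    have := Torus.volume_closedBall_le c (r := L / 2) (by positivity)
    rwa [mul_div_cancel₀ _ two_ne_zero] at this
  set T : Set (Torus d) := {z : Torus d | ∃ q : ℕ, (H : ℝ) / K ≤ q ∧ q ≤ H ∧ ∀ i, q • z i = 0}
  have hqpos : ∀ q : ℕ, (H : ℝ) / K ≤ q → N ≤ q ∧ 0 < q := by
    intro q hq
    have : ((N + 1 : ℕ) : ℝ) ≤ q := by push_cast; linarith
    have : N + 1 ≤ q := by exact_mod_cast this
    omega
  have hTfin : T.Finite := (finite_torsion_points d H).subset fun z ⟨q, h1, h2, h3⟩ =>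
    ⟨q, (hqpos q h1).2, h2, h3⟩
  have hcov : G ⊆ ⋃ z ∈ hTfin.toFinset, closedBall z ρ := by
    rintro x ⟨⟨q, hq1, hq2, hq3⟩, -⟩
    have hq0 := (hqpos q hq1).2
    choose z hz1 hz2 using fun i => UnitAddCircle.exists_torsion_near hq0 (x i)
    simp only [mem_iUnion]
    refine ⟨z, hTfin.mem_toFinset.mpr ⟨q, hq1, hq2, hz1⟩, ?_⟩
    rw [mem_closedBall, dist_pi_le_iff hρ0.le]
    intro i
    calc _ ≤ _ := hz2 i
      _ ≤ δ / (H / K) := by gcongr; exact hq3 i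
      _ = ρ := hδρ
  obtain ⟨ν, hνac, hνuniv, hν1, hν2, hνV⟩ :=
    Torus.exists_measure_on_rectangles hTfin.toFinset ha0 ha2 haρ hθ0 hθ1 hρ0 hGm hcov
  have hLpow : L ^ (t - d) * L ^ d = L ^ t := by
    rw [← Real.rpow_natCast, ← Real.rpow_add hL, sub_add_cancel]
  refine ⟨ENNReal.ofReal (L ^ (t - d)) • ν, ?_, ?_, fun y r hr => ?_, ?_⟩
  · have : IsFiniteMeasure ν := ⟨hνuniv.trans_lt (hGvol.trans_lt ENNReal.ofReal_lt_top)⟩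
    exact Measure.smul_finite ν ENNReal.ofReal_ne_top
  · exact hνac.smul_left _
  · rw [Measure.smul_apply, smul_eq_mul]
    have h6 : (6 : ℝ) ^ d ≤ (6 * K) ^ d := by gcongr; linarith
    have h1 : 1 ≤ (6 * K) ^ d := one_le_pow₀ (by linarith)
    rcases le_or_gt ρ r with hρr | hρr
    · rcases le_or_gt r L with hrL | hrL
      · calc _ ≤ ENNReal.ofReal (L ^ (t - d)) * ENNReal.ofReal ((2 * (r + 2 * ρ)) ^ d) := by
              gcongr; exact hν1 y r hr
          _ = ENNReal.ofReal (L ^ (t - d) * (2 * (r + 2 * ρ)) ^ d) :=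
              (ENNReal.ofReal_mul (by positivity)).symm
          _ ≤ _ := by
              apply ENNReal.ofReal_le_ofReal
              calc _ ≤ r ^ (t - d) * (6 * r) ^ d := by
                    gcongr ?_ * ?_ ^ d
                    · exact Real.rpow_le_rpow_of_nonpos hr hrL (by linarith)
                    · linarith
                _ = 6 ^ d * r ^ t := by
                    rw [mul_pow, mul_left_comm, ← Real.rpow_natCast r, ← Real.rpow_add hr,
                      sub_add_cancel]
                _ ≤ _ := by gcongr
      · calc _ ≤ ENNReal.ofReal (L ^ (t - d)) * ENNReal.ofReal (L ^ d) := by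
              gcongr; exact (measure_mono (subset_univ _)).trans (hνuniv.trans hGvol)
          _ = ENNReal.ofReal (L ^ t) := by
              rw [← ENNReal.ofReal_mul (by positivity), hLpow]
          _ ≤ _ := by
              apply ENNReal.ofReal_le_ofReal
              calc L ^ t ≤ r ^ t := by gcongr
                _ ≤ _ := le_mul_of_one_le_left (by positivity) h1
    · calc _ ≤ ENNReal.ofReal (L ^ (t - d)) *
            ENNReal.ofReal ((2 * (r + 2 * ρ)) ^ d * ∏ i, (r / a i) ^ θ i) := by
              gcongr; exact hν2 y r hr
        _ = ENNReal.ofReal (L ^ (t - d) * ((2 * (r + 2 * ρ)) ^ d * ∏ i, (r / a i) ^ θ i)) :=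
            (ENNReal.ofReal_mul (by positivity)).symm
        _ ≤ _ := by
            apply ENNReal.ofReal_le_ofReal
            have hprod : ∏ i, (r / a i) ^ θ i =
                r ^ t * (H : ℝ) ^ (∑ i, θ i * (1 + τ i)) := by
              rw [← hθt, Real.rpow_sum_of_pos hr, Real.rpow_sum_of_pos hH0,
                ← Finset.prod_mul_distrib]
              refine Finset.prod_congr rfl fun i _ => ?_
              have : r / a i = r * (H : ℝ) ^ (1 + τ i) := by
                rw [ha]
                simp only
                rw [Real.rpow_neg hH0.le, div_inv_eq_mul]
              rw [this, Real.mul_rpow hr.le (by positivity), ← Real.rpow_mul hH0.le, mul_comm (θ i)]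
            have hρd : ρ ^ d = K ^ d * (H : ℝ) ^ (-((d : ℝ) + 1)) := by
              have hd' : (d : ℝ) ≠ 0 := by positivity
              rw [hρ, mul_pow, ← Real.rpow_natCast ((H : ℝ) ^ _), ← Real.rpow_mul hH0.le]
              congr 2
              field_simp
            have hsmall : L ^ (t - d) *
                ((H : ℝ) ^ (-((d : ℝ) + 1)) * (H : ℝ) ^ (∑ i, θ i * (1 + τ i))) ≤ 1 := by
              rw [← Real.rpow_add hH0]
              calc _ = L ^ (t - d) *
                    (H : ℝ) ^ (-((d : ℝ) + 1 - ∑ i, θ i * (1 + τ i))) := by ring_nf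
                _ ≤ L ^ (t - d) * L ^ ((d : ℝ) - t) := by gcongr
                _ = 1 := by rw [← Real.rpow_add hL]; simp
            have hpos : 0 ≤ ∏ i, (r / a i) ^ θ i :=
              Finset.prod_nonneg fun i _ => by have := ha0 i; positivity
            calc _ ≤ L ^ (t - d) * ((6 * ρ) ^ d * ∏ i, (r / a i) ^ θ i) := by
                  gcongr L ^ (t - d) * (?_ ^ d * _)
                  linarith
              _ = (6 * K) ^ d * r ^ t * (L ^ (t - d) *
                  ((H : ℝ) ^ (-((d : ℝ) + 1)) * (H : ℝ) ^ (∑ i, θ i * (1 + τ i)))) := by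
                  rw [hprod, mul_pow, hρd, mul_pow]
                  ring
              _ ≤ (6 * K) ^ d * r ^ t := mul_le_of_le_one_right (by positivity) hsmall
  · rw [Measure.smul_apply, smul_eq_mul]
    have hV := hνV (approxFrom τ N ∩ ball c L) (by
      rintro z hz ⟨x, hxG, hxz⟩
      obtain ⟨q, hq1, hq2, hq3⟩ := hTfin.mem_toFinset.mp hz
      refine subset_inter (rectangle_subset_approxFrom hτ0 (hqpos q hq1).2 hq2 (hqpos q hq1).1 hq3)
        fun u hu => ?_
      have h1 : dist u z ≤ ρ := (dist_pi_le_iff hρ0.le).mpr fun i =>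
        (mem_ball.mp (hu i (mem_univ i))).le.trans (haρ i)
      have h2 : dist x z ≤ ρ := hxz
      have h3 : dist x c ≤ L / 2 := hxG.2
      have h4 := dist_triangle4 u z x c
      rw [dist_comm z x] at h4
      rw [mem_ball]
      linarith)
    have hG2 : ENNReal.ofReal (L ^ d / 2) ≤ volume G := by
      rwa [mul_div_cancel₀ _ two_ne_zero] at hHvol
    calc _ = ENNReal.ofReal (L ^ (t - d)) * ENNReal.ofReal (L ^ d / 2) := by
          rw [← ENNReal.ofReal_mul (by positivity), ← mul_div_assoc, hLpow]
      _ ≤ _ := by gcongr; exact hG2.trans hV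

/-- The representative in `[0, 1)` of a point of the circle. -/
def circleRep (x : AddCircle (1 : ℝ)) : ℝ := (AddCircle.equivIco (1 : ℝ) 0 x : ℝ)

theorem circleRep_nonneg (x : AddCircle (1 : ℝ)) : 0 ≤ circleRep x :=
  (AddCircle.equivIco (1 : ℝ) 0 x).2.1

theorem circleRep_lt_one (x : AddCircle (1 : ℝ)) : circleRep x < 1 :=
  (AddCircle.equivIco (1 : ℝ) 0 x).2.2.trans_eq (zero_add 1)

theorem coe_circleRep (x : AddCircle (1 : ℝ)) : (circleRep x : AddCircle (1 : ℝ)) = x :=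
  AddCircle.coe_equivIco

theorem circleRep_coe {y : ℝ} (h0 : 0 ≤ y) (h1 : y < 1) :
    circleRep (y : AddCircle (1 : ℝ)) = y :=
  AddCircle.equivIco_coe_of_mem ⟨h0, by simpa using h1⟩

theorem measurable_circleRep : Measurable circleRep :=
  measurable_subtype_coe.comp (AddCircle.measurableEquivIco (1 : ℝ) 0).measurable

theorem floor_two_pow_mul_circleRep_lt (n : ℕ) (x : AddCircle (1 : ℝ)) :
    ⌊2 ^ n * circleRep x⌋₊ < 2 ^ n := by
  rw [Nat.floor_lt (mul_nonneg (by positivity) (circleRep_nonneg x))]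
  push_cast
  exact mul_lt_of_lt_one_right (by positivity) (circleRep_lt_one x)

/-- The index of the dyadic cube of generation `n` containing a given point. -/
def dyadicIndex {d : ℕ} (n : ℕ) (x : Torus d) : Fin d → Fin (2 ^ n) :=
  fun i => ⟨⌊2 ^ n * circleRep (x i)⌋₊, floor_two_pow_mul_circleRep_lt n (x i)⟩

/-- The dyadic cube of generation `n` with index `k`. -/
def dyadicCube {d : ℕ} (n : ℕ) (k : Fin d → Fin (2 ^ n)) : Set (Torus d) :=
  dyadicIndex n ⁻¹' {k}

/-- The centre of a dyadic cube. -/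
def dyadicCenter {d : ℕ} (n : ℕ) (k : Fin d → Fin (2 ^ n)) : Torus d :=
  torusProj fun i => ((k i : ℕ) + 1 / 2) / 2 ^ n

/-- The diameter of the dyadic cubes of generation `n`. -/
def dyadicDiam (n : ℕ) : ℝ := min (1 / 2) (1 / 2 ^ n)

theorem dyadicDiam_pos (n : ℕ) : 0 < dyadicDiam n := by
  unfold dyadicDiam; positivity

theorem dyadicDiam_of_pos {n : ℕ} (hn : 0 < n) : dyadicDiam n = 1 / 2 ^ n := by
  refine min_eq_right (one_div_le_one_div_of_le two_pos ?_)
  simpa using pow_le_pow_right₀ (one_le_two (α := ℝ)) hn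

theorem dyadicDiam_anti : Antitone dyadicDiam := fun m n h =>
  min_le_min_left _ (one_div_le_one_div_of_le (by positivity)
    (pow_le_pow_right₀ one_le_two h))

theorem mem_dyadicCube_iff {d n : ℕ} {k : Fin d → Fin (2 ^ n)} {x : Torus d} :
    x ∈ dyadicCube n k ↔ ∀ i, ((k i : ℕ) : ℝ) / 2 ^ n ≤ circleRep (x i) ∧
      circleRep (x i) < ((k i : ℕ) + 1) / 2 ^ n := by
  simp only [dyadicCube, mem_preimage, mem_singleton_iff, funext_iff, Fin.ext_iff, dyadicIndex]
  refine forall_congr' fun i => ?_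
  rw [Nat.floor_eq_iff (mul_nonneg (by positivity) (circleRep_nonneg _)),
    div_le_iff₀ (by positivity), lt_div_iff₀ (by positivity), mul_comm]

theorem mem_dyadicCube_dyadicIndex {d : ℕ} (n : ℕ) (x : Torus d) :
    x ∈ dyadicCube n (dyadicIndex n x) := rfl

theorem torusProj_mem_dyadicCube {d n : ℕ} {k : Fin d → Fin (2 ^ n)} {y : Fin d → ℝ}
    (h : ∀ i, ((k i : ℕ) : ℝ) / 2 ^ n ≤ y i ∧ y i < ((k i : ℕ) + 1) / 2 ^ n) :
    torusProj y ∈ dyadicCube n k := by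
  rw [mem_dyadicCube_iff]
  intro i
  have h1 : ((k i : ℕ) : ℝ) + 1 ≤ 2 ^ n := by exact_mod_cast (k i).2
  have h2 : circleRep (torusProj y i) = y i :=
    circleRep_coe ((by positivity : (0 : ℝ) ≤ _).trans (h i).1)
      ((h i).2.trans_le ((div_le_one (by positivity)).mpr h1))
  rw [h2]
  exact h i

theorem torusProj_circleRep {d : ℕ} (x : Torus d) : (torusProj fun i => circleRep (x i)) = x :=
  funext fun i => coe_circleRep (x i)

theorem torusProj_add_intCast {d : ℕ} (y : Fin d → ℝ) (m : Fin d → ℤ) :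
    (torusProj fun i => y i + m i) = torusProj y := by
  refine funext fun i => ?_
  have : ((m i : ℝ) : AddCircle (1 : ℝ)) = 0 := by
    rw [AddCircle.coe_eq_zero_iff]
    exact ⟨m i, by simp⟩
  simp only [torusProj, AddCircle.coe_add, this, add_zero]

theorem IsDyadicCube.exists_eq_dyadicCube {d : ℕ} {D : Set (Torus d)} (hD : IsDyadicCube D) :
    ∃ n k, D = dyadicCube n k := by
  obtain ⟨n, k, rfl⟩ := hD
  have h2 : (0 : ℤ) < 2 ^ n := by positivity
  have hm0 : ∀ i, 0 ≤ k i % 2 ^ n := fun i => Int.emod_nonneg _ h2.ne'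
  have hm1 : ∀ i, k i % 2 ^ n < 2 ^ n := fun i => Int.emod_lt_of_pos _ h2
  have hm2 : ∀ i, (k i % 2 ^ n).toNat < 2 ^ n := fun i => by
    zify
    rw [Int.toNat_of_nonneg (hm0 i)]
    exact hm1 i
  refine ⟨n, fun i => ⟨(k i % 2 ^ n).toNat, hm2 i⟩, ?_⟩
  have hk : ∀ i, (((k i % 2 ^ n).toNat : ℕ) : ℝ) = k i - 2 ^ n * ((k i / 2 ^ n : ℤ) : ℝ) := by
    intro i
    have h3 : (((k i % 2 ^ n).toNat : ℕ) : ℤ) = k i - 2 ^ n * (k i / 2 ^ n) := by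
      rw [Int.toNat_of_nonneg (hm0 i), Int.emod_def]
    exact_mod_cast congrArg (Int.cast : ℤ → ℝ) h3
  have hp : (0 : ℝ) < 2 ^ n := by positivity
  apply Subset.antisymm
  · rintro _ ⟨y, hy, rfl⟩
    rw [← torusProj_add_intCast y fun i => -(k i / 2 ^ n)]
    refine torusProj_mem_dyadicCube fun i => ?_
    obtain ⟨h3, h4⟩ := hy i (mem_univ i)
    rw [div_le_iff₀ hp] at h3 ⊢
    rw [lt_div_iff₀ hp] at h4 ⊢
    simp only [hk]
    push_cast
    constructor <;> nlinarith
  · intro x hx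
    rw [mem_dyadicCube_iff] at hx
    refine ⟨fun i => circleRep (x i) + (k i / 2 ^ n : ℤ), fun i _ => ?_, ?_⟩
    · obtain ⟨h3, h4⟩ := hx i
      rw [div_le_iff₀ hp] at h3
      rw [lt_div_iff₀ hp] at h4
      simp only [hk] at h3 h4
      rw [mem_Ico, div_le_iff₀ hp, lt_div_iff₀ hp]
      constructor <;> nlinarith
    · rw [torusProj_add_intCast, torusProj_circleRep]

theorem dyadicIndex_eq_of_le {d m n : ℕ} (h : m ≤ n) {x y : Torus d}
    (hxy : dyadicIndex n x = dyadicIndex n y) : dyadicIndex m x = dyadicIndex m y := by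
  have key : ∀ u : AddCircle (1 : ℝ),
      ⌊2 ^ m * circleRep u⌋₊ = ⌊2 ^ n * circleRep u⌋₊ / 2 ^ (n - m) := by
    intro u
    rw [← Nat.floor_div_natCast]
    congr 1
    push_cast
    rw [eq_div_iff (by positivity), mul_right_comm, ← pow_add, Nat.add_sub_cancel' h]
  refine funext fun i => Fin.ext ?_
  have := congrArg Fin.val (congrFun hxy i)
  simp only [dyadicIndex] at this ⊢
  rw [key, key, this]

theorem dyadicCube_subset_or_disjoint {d m n : ℕ} (h : m ≤ n) (k : Fin d → Fin (2 ^ n))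
    (l : Fin d → Fin (2 ^ m)) :
    dyadicCube n k ⊆ dyadicCube m l ∨ Disjoint (dyadicCube n k) (dyadicCube m l) := by
  rw [or_iff_not_imp_right, Set.not_disjoint_iff]
  rintro ⟨x, hx, hx'⟩ y hy
  have h1 : dyadicIndex n y = dyadicIndex n x := by
    rw [show dyadicIndex n y = k from hy, show dyadicIndex n x = k from hx]
  exact (dyadicIndex_eq_of_le h h1).trans hx'

theorem measurable_dyadicIndex {d : ℕ} (n : ℕ) : Measurable (dyadicIndex (d := d) n) := by
  refine measurable_pi_lambda _ fun i => ?_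
  have : Measurable fun x : Torus d => ⌊2 ^ n * circleRep (x i)⌋₊ :=
    Nat.measurable_floor.comp
      ((measurable_circleRep.comp (measurable_pi_apply i)).const_mul _)
  refine measurable_to_countable' fun j => ?_
  have h2 : (fun x : Torus d => dyadicIndex n x i) ⁻¹' {j} =
      (fun x : Torus d => ⌊2 ^ n * circleRep (x i)⌋₊) ⁻¹' {(j : ℕ)} := by
    ext x
    simp [dyadicIndex, Fin.ext_iff]
  rw [h2]
  exact this (measurableSet_singleton _)

theorem measurableSet_dyadicCube {d n : ℕ} (k : Fin d → Fin (2 ^ n)) :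
    MeasurableSet (dyadicCube n k) :=
  measurable_dyadicIndex n (measurableSet_singleton k)

theorem pairwise_disjoint_dyadicCube {d : ℕ} (n : ℕ) :
    Pairwise (Function.onFun Disjoint (dyadicCube (d := d) n)) := fun _ _ hkl =>
  Set.disjoint_left.mpr fun _ hx hy => hkl (Eq.trans (Eq.symm hx) hy)

theorem dyadicCube_subset_closedBall {d n : ℕ} (k : Fin d → Fin (2 ^ n)) :
    dyadicCube n k ⊆ closedBall (dyadicCenter n k) (1 / 2 ^ (n + 1)) := by
  intro x hx
  rw [mem_dyadicCube_iff] at hx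
  rw [mem_closedBall, dist_pi_le_iff (by positivity)]
  intro i
  obtain ⟨h1, h2⟩ := hx i
  rw [← coe_circleRep (x i), dist_eq_norm, dyadicCenter, torusProj, ← AddCircle.coe_sub]
  refine (UnitAddCircle.norm_coe_le_abs _).trans ?_
  rw [div_le_iff₀ (by positivity)] at h1
  rw [lt_div_iff₀ (by positivity)] at h2
  have hp : (0 : ℝ) < 2 ^ n := by positivity
  have h3 : circleRep (x i) - ((k i : ℕ) + 1 / 2) / 2 ^ n =
      (circleRep (x i) * 2 ^ n - ((k i : ℕ) + 1 / 2)) / 2 ^ n := by field_simp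
  rw [h3, abs_div, abs_of_pos hp, pow_succ, div_le_div_iff₀ hp (by positivity)]
  have h4 : |circleRep (x i) * 2 ^ n - ((k i : ℕ) + 1 / 2)| ≤ 1 / 2 := by
    rw [abs_le]; constructor <;> linarith
  nlinarith

theorem dist_le_of_mem_dyadicCube {d n : ℕ} {k : Fin d → Fin (2 ^ n)} {x y : Torus d}
    (hx : x ∈ dyadicCube n k) (hy : y ∈ dyadicCube n k) : dist x y ≤ 1 / 2 ^ n := by
  have h1 : dist x _ ≤ _ := dyadicCube_subset_closedBall k hx
  have h2 : dist y _ ≤ _ := dyadicCube_subset_closedBall k hy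
  have h3 := dist_triangle_right x y (dyadicCenter n k)
  have h : (1 : ℝ) / 2 ^ n = 1 / 2 ^ (n + 1) + 1 / 2 ^ (n + 1) := by
    rw [pow_succ]; field_simp; norm_num
  linarith

theorem ball_subset_dyadicCube {d n : ℕ} (k : Fin d → Fin (2 ^ n)) :
    ball (dyadicCenter n k) (1 / 2 ^ (n + 1)) ⊆ dyadicCube n k := by
  intro x hx
  have hp : (0 : ℝ) < 2 ^ n := by positivity
  have h1 : ∀ i, ∃ v : ℝ, (v : AddCircle (1 : ℝ)) = x i - dyadicCenter n k i ∧
      |v| < 1 / 2 ^ (n + 1) := fun i => by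
    obtain ⟨v, hv, hvn⟩ := UnitAddCircle.exists_real_abs_eq_norm (x i - dyadicCenter n k i)
    refine ⟨v, hv, ?_⟩
    rw [hvn, ← dist_eq_norm]
    exact (dist_le_pi_dist _ _ i).trans_lt hx
  choose v hv hvn using h1
  have h2 : x = torusProj fun i => v i + ((k i : ℕ) + 1 / 2) / 2 ^ n := by
    refine funext fun i => ?_
    simp only [torusProj, AddCircle.coe_add, hv]
    simp [dyadicCenter, torusProj]
  rw [h2]
  refine torusProj_mem_dyadicCube fun i => ?_
  have h3 := hvn i
  rw [abs_lt, pow_succ, ← div_div] at h3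
  have e1 : ((k i : ℕ) : ℝ) / 2 ^ n = ((k i : ℕ) + 1 / 2) / 2 ^ n - 1 / 2 ^ n / 2 := by ring
  have e2 : (((k i : ℕ) : ℝ) + 1) / 2 ^ n = ((k i : ℕ) + 1 / 2) / 2 ^ n + 1 / 2 ^ n / 2 := by ring
  rw [e1, e2]
  constructor <;> linarith [h3.1, h3.2]

theorem Torus.volume_ball {d : ℕ} (x : Torus d) {r : ℝ} (hr : 0 < r) (hr' : r ≤ 1 / 2) :
    volume (ball x r) = ENNReal.ofReal ((2 * r) ^ d) := by
  rw [← Torus.volume_closedBall x hr.le hr', ball_pi _ hr, closedBall_pi _ hr.le, volume_pi_pi,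
    volume_pi_pi]
  exact Finset.prod_congr rfl fun i _ => measure_congr AddCircle.closedBall_ae_eq_ball.symm

theorem one_div_two_pow_succ_le_half (n : ℕ) : (1 : ℝ) / 2 ^ (n + 1) ≤ 1 / 2 :=
  one_div_le_one_div_of_le two_pos (le_self_pow₀ one_le_two n.succ_ne_zero)

theorem volume_dyadicCube {d n : ℕ} (k : Fin d → Fin (2 ^ n)) :
    volume (dyadicCube n k) = ENNReal.ofReal ((1 / 2 ^ n) ^ d) := by
  have h : (2 : ℝ) * (1 / 2 ^ (n + 1)) = 1 / 2 ^ n := by rw [pow_succ]; field_simp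
  apply le_antisymm
  · have := measure_mono (μ := volume) (dyadicCube_subset_closedBall k)
    rwa [Torus.volume_closedBall _ (by positivity) (one_div_two_pow_succ_le_half n), h] at this
  · have := measure_mono (μ := volume) (ball_subset_dyadicCube k)
    rwa [Torus.volume_ball _ (by positivity) (one_div_two_pow_succ_le_half n), h] at this

/-- The union of the interiors of the dyadic cubes of generation `n`. -/
def dyadicInterior (d n : ℕ) : Set (Torus d) :=
  ⋃ k, ball (dyadicCenter n k) (1 / 2 ^ (n + 1))

theorem isOpen_dyadicInterior (d n : ℕ) : IsOpen (dyadicInterior d n) :=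
  isOpen_iUnion fun _ => isOpen_ball

theorem volume_compl_dyadicInterior (d n : ℕ) : volume (dyadicInterior d n)ᶜ = 0 := by
  have h : (dyadicInterior d n)ᶜ ⊆
      ⋃ k, dyadicCube n k \ ball (dyadicCenter n k) (1 / 2 ^ (n + 1)) := fun x hx =>
    mem_iUnion.mpr ⟨dyadicIndex n x, mem_dyadicCube_dyadicIndex n x, fun h =>
      hx (mem_iUnion.mpr ⟨_, h⟩)⟩
  refine measure_mono_null h (measure_iUnion_null fun k => ?_)
  have h2 : (2 : ℝ) * (1 / 2 ^ (n + 1)) = 1 / 2 ^ n := by rw [pow_succ]; field_simp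
  rw [measure_sdiff (ball_subset_dyadicCube k) measurableSet_ball.nullMeasurableSet
    (by rw [Torus.volume_ball _ (by positivity) (one_div_two_pow_succ_le_half n)]
        exact ENNReal.ofReal_ne_top), volume_dyadicCube,
    Torus.volume_ball _ (by positivity) (one_div_two_pow_succ_le_half n), h2, tsub_self]

theorem mem_ball_of_mem_dyadicInterior {d n : ℕ} {k : Fin d → Fin (2 ^ n)} {x : Torus d}
    (hx : x ∈ dyadicInterior d n) (hxk : x ∈ dyadicCube n k) :
    x ∈ ball (dyadicCenter n k) (1 / 2 ^ (n + 1)) := by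
  obtain ⟨l, hl⟩ := mem_iUnion.mp hx
  have : l = k := Eq.trans (Eq.symm (ball_subset_dyadicCube l hl)) hxk
  exact this ▸ hl

theorem ediam_dyadicCube {d : ℕ} (hd : 0 < d) {n : ℕ} (k : Fin d → Fin (2 ^ n)) :
    ediam (dyadicCube n k) = ENNReal.ofReal (dyadicDiam n) := by
  apply le_antisymm
  · refine ediam_le fun x hx y hy => ?_
    rw [edist_dist]
    refine ENNReal.ofReal_le_ofReal (le_min ?_ ?_)
    · refine (dist_pi_le_iff (by positivity)).mpr fun i => ?_
      rw [dist_eq_norm]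
      simpa using AddCircle.norm_le_half_period (1 : ℝ) (x := x i - y i) one_ne_zero
    · exact dist_le_of_mem_dyadicCube hx hy
  · refine le_of_forall_lt fun b hb => ?_
    obtain ⟨r, rfl⟩ : ∃ r : NNReal, (r : ℝ≥0∞) = b := ⟨b.toNNReal, ENNReal.coe_toNNReal hb.ne_top⟩
    have hr' : (r : ℝ) < dyadicDiam n := by
      rwa [← ENNReal.ofReal_coe_nnreal, ENNReal.ofReal_lt_ofReal_iff (dyadicDiam_pos n)] at hb
    obtain ⟨r', hrr', hr'n⟩ := exists_between hr'
    have hr0 : 0 < r' := r.2.trans_lt hrr'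
    have hp : (0 : ℝ) < 2 ^ n := by positivity
    have hx : (torusProj fun i => ((k i : ℕ) : ℝ) / 2 ^ n) ∈ dyadicCube n k :=
      torusProj_mem_dyadicCube fun i => ⟨le_rfl, by gcongr; linarith⟩
    have hy : (torusProj fun i => ((k i : ℕ) : ℝ) / 2 ^ n + r') ∈ dyadicCube n k :=
      torusProj_mem_dyadicCube fun i => ⟨by linarith, by
        rw [add_div]; gcongr; exact hr'n.trans_le (min_le_right _ _)⟩
    refine lt_of_lt_of_le ?_ (edist_le_ediam_of_mem hy hx)
    rw [edist_dist, ← ENNReal.ofReal_coe_nnreal, ENNReal.ofReal_lt_ofReal_iff']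
    suffices h : r' ≤ dist (torusProj fun i => ((k i : ℕ) : ℝ) / 2 ^ n + r')
        (torusProj fun i => ((k i : ℕ) : ℝ) / 2 ^ n) from ⟨hrr'.trans_le h, hr0.trans_le h⟩
    refine le_trans (le_of_eq ?_) (dist_le_pi_dist _ _ ⟨0, hd⟩)
    rw [dist_eq_norm, torusProj, torusProj, ← AddCircle.coe_sub, add_sub_cancel_left,
      (AddCircle.norm_coe_eq_abs_iff (p := (1 : ℝ)) one_ne_zero).mpr, abs_of_pos hr0]
    rw [abs_of_pos hr0]
    simpa using hr'n.le.trans (min_le_left _ _)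

/-- A measure giving mass at most `|D|^t` to every dyadic cube `D`. -/
def IsDyadicFrostman {d : ℕ} (t : ℝ) (ν : Measure (Torus d)) : Prop :=
  ∀ n (k : Fin d → Fin (2 ^ n)), ν (dyadicCube n k) ≤ ENNReal.ofReal (dyadicDiam n ^ t)

theorem sum_measure_inter_dyadicCube {d : ℕ} (n : ℕ) (μ : Measure (Torus d))
    (A : Set (Torus d)) : ∑ k, μ (A ∩ dyadicCube n k) = μ A := by
  have h := sum_measure_preimage_singleton (μ := μ.restrict A) (f := dyadicIndex (d := d) n)
    Finset.univ fun k _ => measurableSet_dyadicCube k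
  rw [Finset.coe_univ, preimage_univ, Measure.restrict_apply_univ] at h
  rw [← h]
  refine Finset.sum_congr rfl fun k _ => ?_
  rw [inter_comm]
  exact (Measure.restrict_apply (measurableSet_dyadicCube k)).symm

theorem IsDyadicFrostman.isFiniteMeasure {d : ℕ} {t : ℝ} {ν : Measure (Torus d)}
    (h : IsDyadicFrostman t ν) : IsFiniteMeasure ν := by
  refine ⟨?_⟩
  rw [← sum_measure_inter_dyadicCube 0 ν univ]
  refine ENNReal.sum_lt_top.mpr fun k _ => ?_
  rw [univ_inter]
  exact (h 0 k).trans_lt ENNReal.ofReal_lt_top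

theorem IsDyadicFrostman.mono {d : ℕ} {t : ℝ} {ν μ : Measure (Torus d)}
    (h : IsDyadicFrostman t ν) (hμ : μ ≤ ν) : IsDyadicFrostman t μ :=
  fun n k => (hμ _).trans (h n k)

/-- Redistributing the mass of `base` inside the cubes of generation `m`. -/
theorem isDyadicFrostman_sum {d m : ℕ} {t : ℝ} {base : Measure (Torus d)}
    {ν : (Fin d → Fin (2 ^ m)) → Measure (Torus d)}
    (hsupp : ∀ k, ν k (dyadicCube m k)ᶜ = 0)
    (hmass : ∀ k, ν k univ = base (dyadicCube m k))
    (hfine : ∀ k n, m ≤ n → ∀ l : Fin d → Fin (2 ^ n),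
      ν k (dyadicCube n l) ≤ ENNReal.ofReal (dyadicDiam n ^ t))
    (hcoarse : ∀ n, n ≤ m → ∀ l : Fin d → Fin (2 ^ n),
      base (dyadicCube n l) ≤ ENNReal.ofReal (dyadicDiam n ^ t)) :
    IsDyadicFrostman t (∑ k, ν k) ∧ (∑ k, ν k) univ = base univ := by
  have hdisj : ∀ k (Q : Set (Torus d)), Disjoint Q (dyadicCube m k) → ν k Q = 0 := fun k Q hQ =>
    measure_mono_null hQ.subset_compl_right (hsupp k)
  refine ⟨fun n l => ?_, ?_⟩
  · rw [Measure.finsetSum_apply]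
    rcases le_total m n with h | h
    · by_cases hex : ∃ k, dyadicCube n l ⊆ dyadicCube m k
      · obtain ⟨k, hk⟩ := hex
        rw [Finset.sum_eq_single k]
        · exact hfine k n h l
        · intro j _ hj
          exact hdisj j _ ((pairwise_disjoint_dyadicCube m hj).symm.mono_left hk)
        · simp
      · push Not at hex
        rw [Finset.sum_eq_zero fun k _ =>
          hdisj k _ ((dyadicCube_subset_or_disjoint h l k).resolve_left (hex k))]
        exact zero_le
    · refine le_trans (le_of_eq ?_) (hcoarse n h l)
      rw [← sum_measure_inter_dyadicCube m base]
      refine Finset.sum_congr rfl fun k _ => ?_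
      rcases dyadicCube_subset_or_disjoint h k l with hk | hk
      · rw [inter_eq_right.mpr hk, ← hmass k]
        refine le_antisymm (measure_mono (subset_univ _)) ?_
        rw [← union_compl_self (dyadicCube m k)]
        refine (measure_union_le _ _).trans ?_
        rw [hsupp, add_zero]
        exact measure_mono hk
      · rw [hdisj k _ hk.symm, hk.symm.inter_eq, measure_empty]
  · rw [Measure.finsetSum_apply, ← sum_measure_inter_dyadicCube m base]
    exact Finset.sum_congr rfl fun k _ => by rw [hmass, univ_inter]

theorem isOpen_approxFrom {d : ℕ} (τ : Fin d → ℝ) (N : ℕ) : IsOpen (approxFrom τ N) := by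
  have h : approxFrom τ N = ⋃ q : ℕ, ⋃ (_ : N ≤ q ∧ 0 < q),
      ⋂ i, {x : Torus d | (q : ℝ) ^ (τ i) * ‖q • x i‖ < 1} := by
    ext x
    simp only [approxFrom, mem_ofPred_eq, mem_iUnion, mem_iInter, exists_prop, and_assoc]
  rw [h]
  refine isOpen_iUnion fun q => isOpen_iUnion fun _ => isOpen_iInter_of_finite fun i => ?_
  exact isOpen_lt (by fun_prop) continuous_const

theorem Wset_eq_iInter_approxFrom {d : ℕ} (τ : Fin d → ℝ) :
    Wset d τ = ⋂ N, approxFrom τ N := by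
  ext x
  simp only [Wset, mem_ofPred_eq, mem_iInter, approxFrom]
  constructor
  · intro h N
    obtain ⟨q, hq, hN⟩ := h.exists_gt N
    exact ⟨q, hN.le, hq⟩
  · intro h
    refine infinite_of_forall_exists_gt fun N => ?_
    obtain ⟨q, hN, hq⟩ := h (N + 1)
    exact ⟨q, hq, hN⟩

theorem isGδ_Wset {d : ℕ} (τ : Fin d → ℝ) : IsGδ (Wset d τ) := by
  rw [Wset_eq_iInter_approxFrom]
  exact .iInter_of_isOpen fun N => isOpen_approxFrom τ N

/-- The open set `O` carries, in every small dyadic cube `D`, a Frostman measure of the largest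
possible mass `|D|^t`. -/
def HasFullMeasures {d : ℕ} (t : ℝ) (O : Set (Torus d)) : Prop :=
  ∀ n, 0 < n → ∀ k : Fin d → Fin (2 ^ n), ∃ ν : Measure (Torus d), ν ≪ volume ∧
    IsDyadicFrostman t ν ∧ ν (O ∩ dyadicCube n k)ᶜ = 0 ∧
    ν univ = ENNReal.ofReal (dyadicDiam n ^ t)

theorem HasFullMeasures.inter {d : ℕ} {t : ℝ} {O U : Set (Torus d)} (h : HasFullMeasures t O)
    (hU : volume Uᶜ = 0) : HasFullMeasures t (O ∩ U) := by
  intro n hn k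
  obtain ⟨ν, hac, hF, hnull, hmass⟩ := h n hn k
  refine ⟨ν, hac, hF, ?_, hmass⟩
  rw [inter_right_comm, compl_inter]
  exact measure_union_null hnull (hac hU)

/-- One step of the Cantor type construction. -/
theorem HasFullMeasures.exists_closure_subset {d : ℕ} {t : ℝ} {O V : Set (Torus d)}
    (hO : HasFullMeasures t O) (hOo : IsOpen O) (hV : IsOpen V) {ν : Measure (Torus d)}
    (hF : IsDyadicFrostman t ν) {a : ℝ≥0∞} (ha : a < ν V) :
    ∃ (ν' : Measure (Torus d)) (V' : Set (Torus d)), IsDyadicFrostman t ν' ∧ IsOpen V' ∧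
      closure V' ⊆ V ∩ O ∧ a < ν' V' := by
  have := hF.isFiniteMeasure
  obtain ⟨K₀, hK₀V, hK₀, haK₀⟩ := hV.exists_lt_isCompact ha
  obtain ⟨δ, hδ, hδV⟩ := hK₀.exists_thickening_subset_open hV hK₀V
  obtain ⟨m, hm⟩ := exists_pow_lt_of_lt_one hδ (one_half_lt_one (α := ℝ))
  set M := m + 1
  have hM : (1 : ℝ) / 2 ^ M < δ := by
    refine lt_of_le_of_lt ?_ hm
    rw [one_div_pow]
    exact one_div_le_one_div_of_le (by positivity) (pow_le_pow_right₀ one_le_two m.le_succ)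
  have hcube : ∀ k : Fin d → Fin (2 ^ M), ¬Disjoint (dyadicCube M k) K₀ →
      dyadicCube M k ⊆ V := by
    intro k hk x hx
    obtain ⟨y, hy, hyK⟩ := not_disjoint_iff.mp hk
    refine hδV (mem_thickening_iff.mpr ⟨y, hyK, ?_⟩)
    exact (dist_le_of_mem_dyadicCube hx hy).trans_lt hM
  choose μ _ hμF hμnull hμmass using hO M m.succ_pos
  have hs : 0 < dyadicDiam M ^ t := Real.rpow_pos_of_pos (dyadicDiam_pos M) t
  have hs0 : ENNReal.ofReal (dyadicDiam M ^ t) ≠ 0 := (ENNReal.ofReal_pos.mpr hs).ne'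
  set base := ν.restrict K₀
  have hbase : base ≤ ν := Measure.restrict_le_self
  set w : (Fin d → Fin (2 ^ M)) → ℝ≥0∞ := fun k =>
    base (dyadicCube M k) / ENNReal.ofReal (dyadicDiam M ^ t)
  have hw : ∀ k, w k ≤ 1 := fun k =>
    ENNReal.div_le_of_le_mul (by rw [one_mul]; exact (hbase _).trans (hF M k))
  have hnull : ∀ k, (w k • μ k) (O ∩ dyadicCube M k)ᶜ = 0 := fun k => by
    rw [Measure.smul_apply, hμnull, smul_zero]
  obtain ⟨hF', hmass'⟩ := isDyadicFrostman_sum (t := t) (base := base) (ν := fun k => w k • μ k)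
    (fun k => measure_mono_null (compl_subset_compl.mpr inter_subset_right) (hnull k))
    (fun k => by
      rw [Measure.smul_apply, hμmass, smul_eq_mul, ENNReal.div_mul_cancel hs0
        ENNReal.ofReal_ne_top])
    (fun k n _ l => (mul_le_of_le_one_left zero_le (hw k)).trans (hμF k n l))
    (fun n _ l => (hbase _).trans (hF n l))
  set ν' := ∑ k, w k • μ k
  have := hF'.isFiniteMeasure
  have hnull' : ν' (V ∩ O)ᶜ = 0 := by
    rw [Measure.finsetSum_apply]
    refine Finset.sum_eq_zero fun k _ => ?_
    by_cases hk : Disjoint (dyadicCube M k) K₀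
    · have : w k = 0 := by
        simp only [w, base]
        rw [Measure.restrict_apply (measurableSet_dyadicCube k), hk.inter_eq, measure_empty,
          ENNReal.zero_div]
      rw [this, zero_smul]
      rfl
    · refine measure_mono_null (compl_subset_compl.mpr ?_) (hnull k)
      exact fun x hx => ⟨hcube k hk hx.2, hx.1⟩
  have ha' : a < ν' (V ∩ O) := by
    have h1 : ν' univ ≤ ν' (V ∩ O) := by
      rw [← union_compl_self (V ∩ O)]
      exact (measure_union_le _ _).trans (by rw [hnull', add_zero])
    refine lt_of_lt_of_le ?_ h1
    rw [hmass', Measure.restrict_apply_univ]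
    exact haK₀
  obtain ⟨K, hKV, hK, haK⟩ := (hV.inter hOo).exists_lt_isCompact ha'
  obtain ⟨V', hV', hKV', hV'V⟩ :=
    normal_exists_closure_subset hK.isClosed (hV.inter hOo) hKV
  exact ⟨ν', V', hF', hV', hV'V, haK.trans_le (measure_mono hKV')⟩

theorem exists_frostman_rescaling_constant {C s : ℝ} (hC : 0 < C) (hs : 0 < s) :
    ∃ h : ℕ, C * ((1 / 2 ^ h : ℝ) ^ s) ≤ 1 := by
  have h2 : ((1 : ℝ) / 2) ^ s < 1 := Real.rpow_lt_one (by norm_num) (by norm_num) hs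
  obtain ⟨h, hh⟩ := exists_pow_lt_of_lt_one (inv_pos.mpr hC) h2
  refine ⟨h, ?_⟩
  rw [← one_div_pow, ← Real.rpow_natCast, ← Real.rpow_mul (by norm_num), mul_comm (h : ℝ),
    Real.rpow_mul (by norm_num), Real.rpow_natCast]
  calc C * (((1 : ℝ) / 2) ^ s) ^ h ≤ C * C⁻¹ := by gcongr
    _ = 1 := mul_inv_cancel₀ hC.ne'

theorem hasFullMeasures_approxFrom {d : ℕ} (hd : 0 < d) {τ : Fin d → ℝ}
    (hτlow : ∀ i, 1 / (d : ℝ) ≤ τ i) {t : ℝ} (ht : 0 < t) (htD : t < Dval d τ) (N : ℕ) :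
    HasFullMeasures t (approxFrom τ N) := by
  intro n hn k
  have htd : t < d := htD.trans_le (Dval_le_natCast hd τ hτlow)
  obtain ⟨C, hC, hball⟩ := exists_measure_ball_approxFrom hd hτlow ht htD
  obtain ⟨h, hh⟩ := exists_frostman_rescaling_constant (C := 2 * 2 ^ t * C) (s := d - t)
    (by positivity) (by linarith)
  set m := n + h with hm
  have hm0 : 0 < m := by omega
  set u : ℕ → ℝ := fun j => 1 / 2 ^ j with hu
  have hu0 : ∀ j, 0 < u j := fun j => by simp only [hu]; positivity
  have hdu : ∀ j, 0 < j → dyadicDiam j = u j := fun j hj => dyadicDiam_of_pos hj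
  have huanti : ∀ i j, i ≤ j → u j ≤ u i := fun i j hij =>
    one_div_le_one_div_of_le (by positivity) (pow_le_pow_right₀ one_le_two hij)
  set c : ℝ := u n ^ t / u n ^ d with hc
  have hc0 : 0 ≤ c := by have := hu0 n; positivity
  set base : Measure (Torus d) := ENNReal.ofReal c • volume.restrict (dyadicCube n k)
  have hbase_apply : ∀ j (l : Fin d → Fin (2 ^ j)),
      base (dyadicCube j l) ≤ ENNReal.ofReal (c * u j ^ d) := by
    intro j l
    rw [Measure.smul_apply, smul_eq_mul, ENNReal.ofReal_mul hc0, ← volume_dyadicCube l]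
    gcongr
    exact Measure.restrict_le_self
  have hbase_univ : base univ = ENNReal.ofReal (u n ^ t) := by
    rw [Measure.smul_apply, smul_eq_mul, Measure.restrict_apply_univ, volume_dyadicCube,
      ← ENNReal.ofReal_mul hc0]
    congr 1
    exact div_mul_cancel₀ _ (pow_pos (hu0 n) d).ne'
  have hcoarse : ∀ j, j ≤ m → ∀ l : Fin d → Fin (2 ^ j),
      base (dyadicCube j l) ≤ ENNReal.ofReal (dyadicDiam j ^ t) := by
    intro j _ l
    rcases le_total j n with hj | hj
    · refine (measure_mono (subset_univ _)).trans ?_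
      rw [hbase_univ, ← hdu n hn]
      have h0 := (dyadicDiam_pos n).le
      exact ENNReal.ofReal_le_ofReal (Real.rpow_le_rpow h0 (dyadicDiam_anti hj) ht.le)
    · refine (hbase_apply j l).trans (ENNReal.ofReal_le_ofReal ?_)
      rw [hdu j (by omega), hc, ← Real.rpow_natCast, ← Real.rpow_natCast,
        ← Real.rpow_sub (hu0 n)]
      calc u n ^ (t - d) * u j ^ (d : ℝ) ≤ u j ^ (t - d) * u j ^ (d : ℝ) := by
            refine mul_le_mul_of_nonneg_right ?_ (Real.rpow_nonneg (hu0 j).le _)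
            exact Real.antitoneOn_rpow_Ioi_of_exponent_nonpos (by linarith) (hu0 j) (hu0 n)
              (huanti n j hj)
        _ = u j ^ t := by rw [← Real.rpow_add (hu0 j)]; congr 1; ring
  choose μ hμfin hμac hμball hμmass using fun l : Fin d → Fin (2 ^ m) =>
    hball (dyadicCenter m l) (1 / 2 ^ (m + 1)) (by positivity) (one_div_two_pow_succ_le_half m) N
  set A : (Fin d → Fin (2 ^ m)) → Set (Torus d) := fun l => approxFrom τ N ∩ dyadicCube m l
  have hA : ∀ l, MeasurableSet (A l) := fun l =>
    (isOpen_approxFrom τ N).measurableSet.inter (measurableSet_dyadicCube l)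
  have hAlow : ∀ l, ENNReal.ofReal (u (m + 1) ^ t / 2) ≤ μ l (A l) := fun l =>
    (hμmass l).trans (measure_mono (inter_subset_inter_right _ (ball_subset_dyadicCube l)))
  have hlow0 : 0 < u (m + 1) ^ t / 2 := by have := hu0 (m + 1); positivity
  have hA0 : ∀ l, μ l (A l) ≠ 0 := fun l =>
    ((ENNReal.ofReal_pos.mpr hlow0).trans_le (hAlow l)).ne'
  set w : (Fin d → Fin (2 ^ m)) → ℝ≥0∞ := fun l => base (dyadicCube m l) / μ l (A l)
  set ν : (Fin d → Fin (2 ^ m)) → Measure (Torus d) := fun l => w l • (μ l).restrict (A l)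
  have hνnull : ∀ l, ν l (A l)ᶜ = 0 := fun l => by
    rw [Measure.smul_apply, Measure.restrict_apply (hA l).compl, compl_inter_self, measure_empty,
      smul_zero]
  have hw : ∀ l, w l ≤ ENNReal.ofReal (c * u m ^ d / (u (m + 1) ^ t / 2)) := fun l => by
    rw [ENNReal.ofReal_div_of_pos hlow0]
    exact ENNReal.div_le_div (hbase_apply m l) (hAlow l)
  have hum : u (m + 1) = u m / 2 := by simp only [hu, pow_succ]; field_simp
  have humn : u m = u n * u h := by simp only [hu, hm, pow_add]; field_simp
  have hconst : c * u m ^ d / (u (m + 1) ^ t / 2) * C ≤ 1 := by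
    refine le_trans (le_of_eq ?_) hh
    have h1 := Real.rpow_pos_of_pos (hu0 n) t
    have h2 := Real.rpow_pos_of_pos (hu0 h) t
    have h3 := hu0 n
    have h4 := hu0 h
    rw [hum, humn, hc, Real.div_rpow (by positivity) two_pos.le, Real.mul_rpow h3.le h4.le,
      Real.rpow_sub h4, Real.rpow_natCast, mul_pow]
    field_simp
  obtain ⟨hF, hmass⟩ := isDyadicFrostman_sum (t := t) (base := base) (ν := ν)
    (fun l => measure_mono_null (compl_subset_compl.mpr inter_subset_right) (hνnull l))
    (fun l => by
      rw [Measure.smul_apply, Measure.restrict_apply_univ, smul_eq_mul,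
        ENNReal.div_mul_cancel (hA0 l) (measure_ne_top _ _)])
    (fun l j hj q => by
      have hj0 := hu0 j
      have hj1 := hu0 (j + 1)
      have h1 : μ l (dyadicCube j q) ≤ ENNReal.ofReal (C * u j ^ t) :=
        ((measure_mono (dyadicCube_subset_closedBall q)).trans (hμball l _ _ hj1)).trans
          (ENNReal.ofReal_le_ofReal (by gcongr; exact huanti _ _ j.le_succ))
      rw [Measure.smul_apply, smul_eq_mul, hdu j (by omega)]
      refine (mul_le_mul' (hw l) ((Measure.restrict_le_self _).trans h1)).trans ?_
      rw [← ENNReal.ofReal_mul (by have := hu0 m; positivity), ← mul_assoc]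
      exact ENNReal.ofReal_le_ofReal (mul_le_of_le_one_left (by positivity) hconst))
    hcoarse
  refine ⟨∑ l, ν l, ?_, hF, ?_, by rw [hmass, hbase_univ, hdu n hn]⟩
  · intro s hs
    rw [Measure.finsetSum_apply]
    refine Finset.sum_eq_zero fun l _ => ?_
    rw [Measure.smul_apply, Measure.restrict_le_self.absolutelyContinuous (hμac l hs), smul_zero]
  · rw [Measure.finsetSum_apply]
    refine Finset.sum_eq_zero fun l _ => ?_
    rcases dyadicCube_subset_or_disjoint (Nat.le_add_right n h) l k with hl | hl
    · exact measure_mono_null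
        (compl_subset_compl.mpr (inter_subset_inter_right _ hl)) (hνnull l)
    · have : w l = 0 := by
        have h0 : base (dyadicCube m l) = 0 := by
          rw [Measure.smul_apply, Measure.restrict_apply (measurableSet_dyadicCube l),
            hl.inter_eq, measure_empty, smul_zero]
        simp only [w, h0, ENNReal.zero_div]
      simp only [ν, this, zero_smul]
      rfl

theorem ediam_dyadicCube_rpow {d : ℕ} (hd : 0 < d) {n : ℕ} (k : Fin d → Fin (2 ^ n)) (t : ℝ) :
    ediam (dyadicCube n k) ^ t = ENNReal.ofReal (dyadicDiam n ^ t) := by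
  rw [ediam_dyadicCube hd, ENNReal.ofReal_rpow_of_pos (dyadicDiam_pos n)]

theorem dyadicContent_mono {d : ℕ} (t : ℝ) {E F : Set (Torus d)} (h : E ⊆ F) :
    dyadicContent t E ≤ dyadicContent t F :=
  iInf_mono fun _ => iInf_mono fun _ => le_iInf fun hF => iInf_le_of_le (h.trans hF) le_rfl

theorem dyadicContent_eq_top {d : ℕ} (hd : 0 < d) {t : ℝ} (ht : t ≤ 0) (E : Set (Torus d)) :
    dyadicContent t E = ⊤ := by
  refine top_le_iff.mp (le_iInf fun f => le_iInf fun hf => le_iInf fun _ => ?_)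
  rw [← ENNReal.tsum_const_eq_top_of_ne_zero (α := ℕ) one_ne_zero]
  refine ENNReal.tsum_le_tsum fun j => ?_
  obtain ⟨n, k, hk⟩ := (hf j).exists_eq_dyadicCube
  change 1 ≤ ediam (f j) ^ t
  rw [hk, ediam_dyadicCube_rpow hd, ENNReal.one_le_ofReal]
  refine Real.one_le_rpow_of_pos_of_le_one_of_nonpos (dyadicDiam_pos n) ?_ ht
  exact (min_le_left _ _).trans one_half_lt_one.le

theorem le_dyadicContent_iInter {d : ℕ} (hd : 0 < d) {t : ℝ} {O : ℕ → Set (Torus d)}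
    (hOo : ∀ j, IsOpen (O j)) (hO : ∀ j, HasFullMeasures t (O j)) {n : ℕ} (hn : 0 < n)
    (k : Fin d → Fin (2 ^ n)) :
    ENNReal.ofReal (dyadicDiam n ^ t) ≤ dyadicContent t ((⋂ j, O j) ∩ dyadicCube n k) := by
  refine le_of_forall_lt_imp_le_of_dense fun a ha =>
    le_iInf fun f => le_iInf fun hf => le_iInf fun hcov => ?_
  choose m l hml using fun j => (hf j).exists_eq_dyadicCube
  let P := {p : Measure (Torus d) × Set (Torus d) //
    IsDyadicFrostman t p.1 ∧ IsOpen p.2 ∧ a < p.1 p.2}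
  have hstep : ∀ (j : ℕ) (p : P), ∃ p' : P,
      closure p'.1.2 ⊆ p.1.2 ∩ (O j ∩ dyadicInterior d j) := by
    rintro j ⟨⟨ν, V⟩, hF, hV, haV⟩
    obtain ⟨ν', V', hF', hV', hVV', haV'⟩ :=
      ((hO j).inter (volume_compl_dyadicInterior d j)).exists_closure_subset
        ((hOo j).inter (isOpen_dyadicInterior d j)) hV hF haV
    exact ⟨⟨⟨ν', V'⟩, hF', hV', haV'⟩, hVV'⟩
  choose next hnext using hstep
  obtain ⟨ν₀, -, hF₀, hnull₀, hmass₀⟩ :=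
    (hO 0).inter (volume_compl_dyadicInterior d n) n hn k
  have hstart : a < ν₀ (ball (dyadicCenter n k) (1 / 2 ^ (n + 1))) := by
    rw [← hmass₀] at ha
    refine ha.trans_le ?_
    rw [← union_compl_self (O 0 ∩ dyadicInterior d n ∩ dyadicCube n k)]
    refine (measure_union_le _ _).trans ?_
    rw [hnull₀, add_zero]
    exact measure_mono fun x hx => mem_ball_of_mem_dyadicInterior hx.1.2 hx.2
  let s : ℕ → P := fun j => Nat.rec ⟨⟨ν₀, _⟩, hF₀, isOpen_ball, hstart⟩ next j
  have hs : ∀ j, closure (s (j + 1)).1.2 ⊆ (s j).1.2 ∩ (O j ∩ dyadicInterior d j) :=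
    fun j => hnext j (s j)
  have hanti : Antitone fun j => closure (s j).1.2 :=
    antitone_nat_of_succ_le fun j => (hs j).trans (inter_subset_left.trans subset_closure)
  have hmem : ∀ x ∈ ⋂ j, closure (s j).1.2,
      (⋃ j, ball (dyadicCenter (m j) (l j)) (1 / 2 ^ (m j + 1))) ∈ 𝓝 x := by
    intro x hx
    have hx' : ∀ j, x ∈ (s j).1.2 ∩ (O j ∩ dyadicInterior d j) := fun j =>
      hs j (mem_iInter.mp hx (j + 1))
    obtain ⟨j, hj⟩ := mem_iUnion.mp
      (hcov ⟨mem_iInter.mpr fun j => (hx' j).2.1, ball_subset_dyadicCube k (hx' 0).1⟩)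
    rw [hml] at hj
    exact (isOpen_iUnion fun _ => isOpen_ball).mem_nhds
      (mem_iUnion.mpr ⟨j, mem_ball_of_mem_dyadicInterior (hx' (m j)).2.2 hj⟩)
  obtain ⟨i, hi⟩ := exists_subset_nhds_of_isCompact hanti.directed_ge
    (fun j => isClosed_closure.isCompact) hmem
  obtain ⟨hF, -, haV⟩ := (s i).2
  calc a ≤ (s i).1.1 (⋃ j, ball (dyadicCenter (m j) (l j)) (1 / 2 ^ (m j + 1))) :=
        haV.le.trans (measure_mono (subset_closure.trans hi))
    _ ≤ ∑' j, (s i).1.1 (ball (dyadicCenter (m j) (l j)) (1 / 2 ^ (m j + 1))) :=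
        measure_iUnion_le _
    _ ≤ ∑' j, ediam (f j) ^ t := ENNReal.tsum_le_tsum fun j => by
        rw [hml, ediam_dyadicCube_rpow hd]
        exact (measure_mono (ball_subset_dyadicCube _)).trans (hF _ _)

theorem exists_dyadicCube_subset_pos {d n : ℕ} (k : Fin d → Fin (2 ^ n)) :
    ∃ n' : ℕ, 0 < n' ∧ ∃ k' : Fin d → Fin (2 ^ n'),
      dyadicCube n' k' ⊆ dyadicCube n k ∧ dyadicDiam n' = dyadicDiam n := by
  rcases n.eq_zero_or_pos with rfl | hn
  · refine ⟨1, one_pos, 0, fun x _ => Subsingleton.elim (α := Fin d → Fin 1) _ _, ?_⟩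
    norm_num [dyadicDiam]
  · exact ⟨n, hn, k, Subset.rfl, rfl⟩

/-- **Example: large intersection property of `W(τ)`.** If `1/d ≤ τ_1 ≤ … ≤ τ_d`, then
`W(τ) ∈ 𝒢^{D(τ)}(𝕋^d)`. -/
theorem Wset_mem_largeIntersectionClass
    (d : ℕ) (hd : 0 < d) (τ : Fin d → ℝ)
    (hτmono : Monotone τ) (hτlow : ∀ i, 1 / (d : ℝ) ≤ τ i) :
    MemLargeIntersectionClass (Dval d τ) (Wset d τ) := by
  refine ⟨isGδ_Wset τ, fun D hD t htD => ?_⟩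
  rcases le_or_gt t 0 with ht | ht
  · rw [dyadicContent_eq_top hd ht]
    exact le_top
  obtain ⟨n, k, rfl⟩ := hD.exists_eq_dyadicCube
  obtain ⟨n', hn', k', hsub, hdiam⟩ := exists_dyadicCube_subset_pos k
  change ediam (dyadicCube n k) ^ t ≤ _
  rw [ediam_dyadicCube_rpow hd, ← hdiam, Wset_eq_iInter_approxFrom]
  exact (le_dyadicContent_iInter hd (isOpen_approxFrom τ)
    (hasFullMeasures_approxFrom hd hτlow ht htD) hn' k').trans
      (dyadicContent_mono t (inter_subset_inter_right _ hsub))
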